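/- arXiv:2112.08568 — 2 statements merged into one kernel-verified Lean document; each statement's English description precedes it below -/
import Mathlib

section
/- Hypergeometric expression for the archimedean transform: Fix η > 40, H ∈ C_η, and α = (α₁, α₂, α₃) ∈ ℂ³ with Re α_i = 0 and α₁ + α₂ + α₃ = 0. Let (s₀, s) ∈ ℂ² satisfy Re s₀ > 1/100, Re s < 4, 2·Re s − Re s₀ − 1/100 > 0, and assume 2·Re s + Re s₀ − η + 1/2 is not an odd integer. Then (F_α H)(s₀, s) = 2π^{3/2}·(I₁ − I₂), where, with s₁ = (η − 1/2) + it₁, I₁ := (1/(2π)) ∫_ℝ ĥ(s − s₁ − 1/2) · (∏_{i=1}^{3} Γ((s₁−α_i)/2)/Γ((1+s₁)/2 − s₀)) · π^{−s₁} · sec(π(2s + s₀ − s₁)/2) · 4F̂3(s − s₀/2, (s₀+α₁)/2, (s₀+α₂)/2, (s₀+α₃)/2 ; 1/2, (s₀+s₁)/2, s + 1/2 + (s₀−s₁)/2 | 1) dt₁, and I₂ := (1/(2π)) ∫_ℝ ĥ(s − s₁ − 1/2) · (∏_{i=1}^{3} Γ((s₁−α_i)/2)/Γ((1+s₁)/2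 − s₀)) · π^{−s₁} · sec(π(2s + s₀ − s₁)/2) · 4F̂3(1/2 − s₀ + s₁/2, 1/2 − s + (s₁+α₁)/2, 1/2 − s + (s₁+α₂)/2, 1/2 − s + (s₁+α₃)/2 ; 1/2 − s + s₁, 1 − s − (s₀−s₁)/2, 3/2 − s − (s₀−s₁)/2 | 1) dt₁. -/
open Complex MeasureTheory Set

/-- The K-Bessel function `K_μ(x) = ∫₀^∞ exp(−x cosh t) cosh(μt) dt`. -/
noncomputable def KBessel (μ : ℂ) (x : ℝ) : ℂ :=
  ∫ t in Ioi (0:ℝ), Complex.exp (-(x : ℂ) * (Real.cosh t : ℂ)) * Complex.cosh (μ * (t : ℂ))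

/-- The GL(2) Whittaker function `W_μ(y) = 2√y K_μ(2πy)`. -/
noncomputable def W2 (μ : ℂ) (y : ℝ) : ℂ :=
  2 * (Real.sqrt y : ℂ) * KBessel μ (2 * Real.pi * y)

/-- The class `C_η` of test functions. -/
def MemCeta (η : ℝ) (H : ℂ → ℂ) : Prop :=
  DifferentiableOn ℂ H {μ : ℂ | |μ.re| < 2 * η} ∧
  (∀ μ : ℂ, |μ.re| < 2 * η → H (-μ) = H μ) ∧
  ∃ C : ℝ, ∀ μ : ℂ, |μ.re| < 2 * η → ‖H μ‖ ≤ C * Real.exp (-2 * Real.pi * |μ.im|)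

/-- The inverse Kontorovich–Lebedev transform. -/
noncomputable def Hflat (H : ℂ → ℂ) (y : ℝ) : ℂ :=
  (1 / (4 * (Real.pi : ℂ))) * ∫ t : ℝ,
    H (t * I) * W2 (t * I) y / (Complex.Gamma (t * I) * Complex.Gamma (-(t * I)))

/-- Mellin transform `ĥ(w) := ∫₀^∞ h(y) y^{w−1} dy`. -/
noncomputable def mellinT (h : ℝ → ℂ) (w : ℂ) : ℂ :=
  ∫ y in Ioi (0:ℝ), h y * (y : ℂ) ^ (w - 1)

/-- The archimedean transform `(F_α H)(s₀, s)` (at `φ = π/2`, in its streamlined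
Mellin–Barnes form), a double integral over `s₁ = (η − 1/2) + it₁` and
`u = 1/100 + iv`. -/
noncomputable def FtransMain (η : ℝ) (α : Fin 3 → ℂ) (H : ℂ → ℂ) (s0 s : ℂ) : ℂ :=
  (Real.sqrt Real.pi : ℂ) * (1 / (2 * (Real.pi : ℂ))) ^ 2 *
    ∫ t1 : ℝ, ∫ v : ℝ,
      let s1 : ℂ := ((η : ℝ) - 1/2 : ℝ) + t1 * Complex.I
      let u : ℂ := 1/100 + v * Complex.I
      mellinT (Hflat H) (s - s1 - 1/2) * (Real.pi : ℂ) ^ (-s1) *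
        ((∏ i, Complex.Gamma ((s1 - α i) / 2)) / Complex.Gamma ((1 + s1) / 2 - s0)) *
        (Complex.Gamma (u / 2) * Complex.Gamma ((s1 - s0 + u) / 2 + 1/2 - s) *
          (∏ i, Complex.Gamma ((s0 - u + α i) / 2)) * Complex.Gamma (s - (s0 + u) / 2)) /
        (Complex.Gamma ((1 - u) / 2) * Complex.Gamma ((s0 - u + s1) / 2))

/-- The (completed) hypergeometric value
`4F̂3(A₁,A₂,A₃,A₄; B₁,B₂,B₃ | 1) = Σ_n Γ(A₁+n)⋯Γ(A₄+n)/(Γ(B₁+n)Γ(B₂+n)Γ(B₃+n) n!)`. -/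
noncomputable def hyp4F3hat (A1 A2 A3 A4 B1 B2 B3 : ℂ) : ℂ :=
  ∑' n : ℕ, Complex.Gamma (A1 + n) * Complex.Gamma (A2 + n) * Complex.Gamma (A3 + n) *
      Complex.Gamma (A4 + n) /
    (Complex.Gamma (B1 + n) * Complex.Gamma (B2 + n) * Complex.Gamma (B3 + n) *
      (Nat.factorial n : ℂ))

section Lemmas

open Filter Topology

/-- The integral of `f` over the boundary of the rectangle `[x₁, x₀] × [-T, T]`. -/
noncomputable def rectIntegral (f : ℂ → ℂ) (x₁ x₀ T : ℝ) : ℂ :=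
  (∫ x : ℝ in x₁..x₀, f (x + (-T : ℝ) * I)) - (∫ x : ℝ in x₁..x₀, f (x + T * I)) +
    I * (∫ y : ℝ in (-T)..T, f (x₀ + y * I)) - I * (∫ y : ℝ in (-T)..T, f (x₁ + y * I))

lemma integral_inv_of_mem_slitPlane (γ : ℝ → ℂ) (d : ℂ) (a b : ℝ)
    (hγ : ∀ t ∈ uIcc a b, HasDerivAt γ d t) (hs : ∀ t ∈ uIcc a b, γ t ∈ slitPlane) :
    ∫ t in a..b, d / γ t = log (γ b) - log (γ a) := by
  refine intervalIntegral.integral_eq_sub_of_hasDerivAt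
    (f := fun t => log (γ t)) (fun t ht => (hγ t ht).clog_real (hs t ht)) ?_
  refine ContinuousOn.intervalIntegrable fun t ht => ?_
  exact (continuousAt_const.div (hγ t ht).continuousAt
    (slitPlane_ne_zero (hs t ht))).continuousWithinAt

lemma rectIntegral_inv_sub (p : ℂ) (x₁ x₀ T : ℝ) (h₁ : x₁ < p.re) (h₀ : p.re < x₀)
    (hT : |p.im| < T) : rectIntegral (fun z => 1 / (z - p)) x₁ x₀ T = 2 * Real.pi * I := by
  obtain ⟨hT1, hT2⟩ := abs_lt.1 hT
  have hh : ∀ (y : ℝ) (t : ℝ), HasDerivAt (fun x : ℝ => (x : ℂ) + y * I - p) 1 t := fun y t =>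
    ((Complex.ofRealCLM.hasDerivAt (x := t)).add_const _).sub_const _
  have hv : ∀ (x : ℝ) (t : ℝ), HasDerivAt (fun y : ℝ => (x : ℂ) + y * I - p) I t := fun x t => by
    simpa using (((Complex.ofRealCLM.hasDerivAt (x := t)).mul_const I).const_add (x : ℂ)).sub_const p
  have hB := integral_inv_of_mem_slitPlane (fun x : ℝ => (x : ℂ) + (-T : ℝ) * I - p) 1 x₁ x₀
    (fun t _ => hh (-T) t) (fun t _ => by
      right; simp; linarith)
  have hU := integral_inv_of_mem_slitPlane (fun x : ℝ => (x : ℂ) + T * I - p) 1 x₁ x₀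
    (fun t _ => hh T t) (fun t _ => by right; simp; linarith)
  have hR := integral_inv_of_mem_slitPlane (fun y : ℝ => (x₀ : ℂ) + y * I - p) I (-T) T
    (fun t _ => hv x₀ t) (fun t _ => by left; simp; linarith)
  have hL := integral_inv_of_mem_slitPlane (fun y : ℝ => -((x₁ : ℂ) + y * I - p)) (-I) (-T) T
    (fun t _ => (hv x₁ t).neg) (fun t _ => by left; simp; linarith)
  have hL' : ∫ y in (-T)..T, -I / -((x₁ : ℂ) + y * I - p) =
      I * ∫ y in (-T)..T, 1 / ((x₁ : ℂ) + y * I - p) := by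
    rw [← intervalIntegral.integral_const_mul]
    refine intervalIntegral.integral_congr fun y _ => ?_
    change -I / -((x₁ : ℂ) + y * I - p) = I * (1 / ((x₁ : ℂ) + y * I - p))
    rw [neg_div_neg_eq, mul_one_div]
  have hR' : ∫ y in (-T)..T, I / ((x₀ : ℂ) + y * I - p) =
      I * ∫ y in (-T)..T, 1 / ((x₀ : ℂ) + y * I - p) := by
    rw [← intervalIntegral.integral_const_mul]
    exact intervalIntegral.integral_congr fun y _ => by simp [div_eq_mul_inv]
  have l1 : log (-((x₁ : ℂ) + T * I - p)) = log ((x₁ : ℂ) + T * I - p) - Real.pi * I := by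
    rw [log, log, norm_neg, arg_neg_eq_arg_sub_pi_of_im_pos (by simp; linarith)]
    push_cast; ring
  have l2 : log (-((x₁ : ℂ) + (-T : ℝ) * I - p)) =
      log ((x₁ : ℂ) + (-T : ℝ) * I - p) + Real.pi * I := by
    rw [log, log, norm_neg, arg_neg_eq_arg_add_pi_of_im_neg (by simp; linarith)]
    push_cast; ring
  rw [hL'] at hL
  rw [hR'] at hR
  rw [rectIntegral, hB, hU, hR, hL, l1, l2]
  ring

/-- The rectangle residue theorem for simple poles. -/
lemma rectIntegral_eq_sum_residues (S : Finset ℂ) (f : ℂ → ℂ) (r : ℂ → ℂ) (x₁ x₀ T : ℝ)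
    (hS : ∀ p ∈ S, x₁ < p.re ∧ p.re < x₀ ∧ |p.im| < T) (hx : x₁ ≤ x₀) (hT : 0 ≤ T)
    (hd : ∀ z : ℂ, x₁ ≤ z.re → z.re ≤ x₀ → z ∉ S → DifferentiableAt ℂ f z)
    (hr : ∀ p ∈ S, Tendsto (fun z => (z - p) * f z) (𝓝[≠] p) (𝓝 (r p))) :
    rectIntegral f x₁ x₀ T = 2 * Real.pi * I * ∑ p ∈ S, r p := by
  induction S using Finset.induction_on generalizing f with
  | empty =>
    have := integral_boundary_rect_eq_zero_of_differentiableOn f (x₁ + (-T : ℝ) * I) (x₀ + T * I)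
      (fun z hz => by
        refine (hd z ?_ ?_ (by simp)).differentiableWithinAt
        · have := hz.1; simp [uIcc_of_le hx] at this; exact this.1
        · have := hz.1; simp [uIcc_of_le hx] at this; exact this.2)
    simpa [rectIntegral] using this
  | insert p S hp ih =>
    obtain ⟨hp1, hp0, hpT⟩ := hS p (Finset.mem_insert_self _ _)
    set g : ℂ → ℂ := fun z => f z - r p / (z - p) with hg
    set g' := Function.update g p (limUnder (𝓝[≠] p) g) with hg'
    have hgd : ∀ z : ℂ, x₁ ≤ z.re → z.re ≤ x₀ → z ∉ insert p S → DifferentiableAt ℂ g z := by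
      intro z h1 h0 hz
      have : z - p ≠ 0 := sub_ne_zero.2 fun h => hz (h ▸ Finset.mem_insert_self _ _)
      exact (hd z h1 h0 hz).sub (by fun_prop (disch := assumption))
    have hgg : ∀ z, z ≠ p → g' z = g z := fun z hz => by simp [hg', hz]
    have hgg' : ∀ z, z ≠ p → g' =ᶠ[𝓝 z] g := fun z hz => by
      filter_upwards [isOpen_ne.mem_nhds hz] with w hw using hgg w hw
    have hU : {z : ℂ | x₁ < z.re ∧ z.re < x₀} ∩ (↑S : Set ℂ)ᶜ ∈ 𝓝 p := by
      refine inter_mem (IsOpen.mem_nhds ?_ ⟨hp1, hp0⟩)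
        (S.finite_toSet.isClosed.isOpen_compl.mem_nhds hp)
      exact (isOpen_lt continuous_const continuous_re).inter
        (isOpen_lt continuous_re continuous_const)
    have hlim : Tendsto (fun z => (z - p) * g z) (𝓝[≠] p) (𝓝 0) := by
      have := (hr p (Finset.mem_insert_self _ _)).sub_const (r p)
      rw [sub_self] at this
      refine this.congr' ?_
      filter_upwards [self_mem_nhdsWithin] with z hz
      have : z - p ≠ 0 := sub_ne_zero.2 hz
      simp only [hg]
      field_simp
    have hgp : DifferentiableAt ℂ g' p := by
      refine (differentiableOn_update_limUnder_of_isLittleO hU ?_ ?_).differentiableAt hU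
      · rintro z ⟨⟨⟨h1, h0⟩, hzS⟩, hzp⟩
        refine (hgd z h1.le h0.le ?_).differentiableWithinAt
        simp only [Finset.mem_insert, not_or]
        exact ⟨hzp, hzS⟩
      · rw [Asymptotics.isLittleO_iff_tendsto']
        · have h2 : Tendsto (fun z => (z - p) * g p) (𝓝[≠] p) (𝓝 0) := by
            have : ContinuousAt (fun z => (z - p) * g p) p := by fun_prop
            have := this.tendsto.mono_left (nhdsWithin_le_nhds (s := {p}ᶜ))
            simpa using this
          have := hlim.sub h2
          rw [sub_zero] at this
          refine this.congr fun z => ?_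
          rw [div_inv_eq_mul]; ring
        · filter_upwards [self_mem_nhdsWithin] with z hz h
          exact absurd (inv_eq_zero.1 h) (sub_ne_zero.2 hz)
    have ih' := ih g' (fun q hq => hS q (Finset.mem_insert_of_mem hq)) (fun z h1 h0 hz => by
        by_cases hzp : z = p
        · rw [hzp]; exact hgp
        · exact (hgd z h1 h0 (by simp [hzp, hz])).congr_of_eventuallyEq (hgg' z hzp))
      (fun q hq => by
        have hqp : q ≠ p := fun h => hp (h ▸ hq)
        have h1 := hr q (Finset.mem_insert_of_mem hq)
        have h2 : Tendsto (fun z => (z - q) * (r p / (z - p))) (𝓝[≠] q) (𝓝 0) := by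
          have : ContinuousAt (fun z => (z - q) * (r p / (z - p))) q := by
            have : q - p ≠ 0 := sub_ne_zero.2 hqp
            fun_prop (disch := assumption)
          have := this.tendsto.mono_left (nhdsWithin_le_nhds (s := {q}ᶜ))
          simpa using this
        have h3 := h1.sub h2
        rw [sub_zero] at h3
        refine h3.congr' ?_
        filter_upwards [nhdsWithin_le_nhds (hgg' q hqp)] with z hz
        rw [hz]; simp only [hg]; ring)
    have hfg : ∀ z, z ≠ p → f z = g' z + r p * (1 / (z - p)) := fun z hz => by
      rw [hgg z hz]; simp only [hg]; ring
    have key : rectIntegral f x₁ x₀ T = rectIntegral g' x₁ x₀ T +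
        r p * rectIntegral (fun z => 1 / (z - p)) x₁ x₀ T := by
      have hcont : ∀ z : ℂ, x₁ ≤ z.re → z.re ≤ x₀ → z ∉ insert p S → ContinuousAt g' z :=
        fun z h1 h0 hz => ((hgd z h1 h0 hz).congr_of_eventuallyEq (hgg' z (fun h =>
          hz (h ▸ Finset.mem_insert_self _ _)))).continuousAt
      have seg : ∀ (γ : ℝ → ℂ) (a b : ℝ), Continuous γ → (∀ t ∈ uIcc a b, x₁ ≤ (γ t).re ∧
          (γ t).re ≤ x₀ ∧ γ t ∉ insert p S) → ∫ t in a..b, f (γ t) =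
          (∫ t in a..b, g' (γ t)) + r p * ∫ t in a..b, 1 / (γ t - p) := by
        intro γ a b hγ h
        have hne : ∀ t ∈ uIcc a b, γ t ≠ p := fun t ht e =>
          (h t ht).2.2 (e ▸ Finset.mem_insert_self _ _)
        rw [← intervalIntegral.integral_const_mul, ← intervalIntegral.integral_add]
        · exact intervalIntegral.integral_congr fun t ht => hfg _ (hne t ht)
        · refine ContinuousOn.intervalIntegrable fun t ht => ContinuousAt.continuousWithinAt ?_
          exact ContinuousAt.comp (f := γ) (g := g')
            (hcont _ (h t ht).1 (h t ht).2.1 (h t ht).2.2) hγ.continuousAt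
        · refine ContinuousOn.intervalIntegrable fun t ht => ContinuousAt.continuousWithinAt ?_
          have : γ t - p ≠ 0 := sub_ne_zero.2 (hne t ht)
          fun_prop (disch := assumption)
      have hor : ∀ y : ℝ, |y| = T → ∀ t ∈ uIcc x₁ x₀, x₁ ≤ ((t : ℂ) + y * I).re ∧
          ((t : ℂ) + y * I).re ≤ x₀ ∧ (t : ℂ) + y * I ∉ insert p S := by
        intro y hy t ht
        rw [uIcc_of_le hx] at ht
        refine ⟨by simpa using ht.1, by simpa using ht.2, fun hm => ?_⟩
        have := (hS _ hm).2.2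
        simp [hy] at this
      have ver : ∀ x : ℝ, x = x₁ ∨ x = x₀ → ∀ t ∈ uIcc (-T) T, x₁ ≤ ((x : ℂ) + t * I).re ∧
          ((x : ℂ) + t * I).re ≤ x₀ ∧ (x : ℂ) + t * I ∉ insert p S := by
        intro x hx' t ht
        refine ⟨?_, ?_, fun hm => ?_⟩
        · rcases hx' with rfl | rfl <;> simp [hx]
        · rcases hx' with rfl | rfl <;> simp [hx]
        · have := hS _ hm
          rcases hx' with rfl | rfl <;> simp at this
      rw [rectIntegral, rectIntegral, rectIntegral,
        seg (fun x : ℝ => (x : ℂ) + (-T : ℝ) * I) x₁ x₀ (by fun_prop) (hor (-T) (by simp [abs_of_nonneg hT])),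
        seg (fun x : ℝ => (x : ℂ) + T * I) x₁ x₀ (by fun_prop) (hor T (abs_of_nonneg hT)),
        seg (fun y : ℝ => (x₀ : ℂ) + y * I) (-T) T (by fun_prop) (ver x₀ (Or.inr rfl)),
        seg (fun y : ℝ => (x₁ : ℂ) + y * I) (-T) T (by fun_prop) (ver x₁ (Or.inl rfl))]
      ring
    rw [key, ih', rectIntegral_inv_sub p x₁ x₀ T hp1 hp0 hpT, Finset.sum_insert hp]
    ring

lemma integrable_exp_neg_mul_abs {δ : ℝ} (hδ : 0 < δ) :
    Integrable fun y : ℝ => Real.exp (-δ * |y|) := by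
  have h : IntegrableOn (fun y : ℝ => Real.exp (-δ * |y|)) (Ioi 0) := by
    refine (exp_neg_integrableOn_Ioi 0 hδ).congr_fun (fun y hy => ?_) measurableSet_Ioi
    simp only [abs_of_pos (mem_Ioi.1 hy)]
  have h' : IntegrableOn (fun y : ℝ => Real.exp (-δ * |y|)) (Iic 0) := by
    refine (integrableOn_exp_mul_Iic hδ 0).congr_fun (fun y hy => ?_) measurableSet_Iic
    simp only [abs_of_nonpos (mem_Iic.1 hy), neg_mul_neg]
  rw [← integrableOn_univ, ← Iic_union_Ioi (a := (0 : ℝ))]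
  exact h'.union h

lemma integrable_of_exp_decay {g : ℝ → ℂ} (hg : Continuous g) {C δ Y : ℝ} (hδ : 0 < δ)
    (hb : ∀ y, Y ≤ |y| → ‖g y‖ ≤ C * Real.exp (-δ * |y|)) : Integrable g := by
  obtain ⟨B, hB⟩ := (isCompact_Icc (a := -Y) (b := Y)).exists_bound_of_continuousOn hg.continuousOn
  refine ((integrable_exp_neg_mul_abs hδ).const_mul
    (|C| + |B| * Real.exp (δ * Y))).mono' hg.aestronglyMeasurable (ae_of_all _ fun y => ?_)
  rcases le_total Y |y| with h | h
  · refine (hb y h).trans ?_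
    gcongr
    nlinarith [le_abs_self C, mul_nonneg (abs_nonneg B) (Real.exp_pos (δ * Y)).le]
  · calc ‖g y‖ ≤ |B| := (hB y (abs_le.1 h)).trans (le_abs_self B)
      _ ≤ |B| * (Real.exp (δ * Y) * Real.exp (-δ * |y|)) := by
          refine le_mul_of_one_le_right (abs_nonneg B) ?_
          rw [← Real.exp_add]
          exact Real.one_le_exp (by nlinarith)
      _ ≤ _ := by
          rw [add_mul, ← mul_assoc]
          linarith [mul_nonneg (abs_nonneg C) (Real.exp_pos (-δ * |y|)).le]

/-- Shifting a vertical line of integration across finitely many simple poles. -/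
lemma integral_vertical_sub_eq_sum_residues (S : Finset ℂ) (f : ℂ → ℂ) (r : ℂ → ℂ) (x₁ x₀ : ℝ)
    (hS : ∀ p ∈ S, x₁ < p.re ∧ p.re < x₀) (hx : x₁ ≤ x₀)
    (hd : ∀ z : ℂ, x₁ ≤ z.re → z.re ≤ x₀ → z ∉ S → DifferentiableAt ℂ f z)
    (hr : ∀ p ∈ S, Tendsto (fun z => (z - p) * f z) (𝓝[≠] p) (𝓝 (r p)))
    {C δ Y : ℝ} (hδ : 0 < δ)
    (hb : ∀ x y : ℝ, x₁ ≤ x → x ≤ x₀ → Y ≤ |y| → ‖f (x + y * I)‖ ≤ C * Real.exp (-δ * |y|)) :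
    (∫ y : ℝ, f (x₀ + y * I)) - (∫ y : ℝ, f (x₁ + y * I)) = 2 * Real.pi * ∑ p ∈ S, r p := by
  have hint : ∀ x : ℝ, x = x₁ ∨ x = x₀ → Integrable fun y : ℝ => f (x + y * I) := by
    intro x hx'
    have hx1 : x₁ ≤ x := by rcases hx' with rfl | rfl <;> simp [hx]
    have hx0 : x ≤ x₀ := by rcases hx' with rfl | rfl <;> simp [hx]
    refine integrable_of_exp_decay ?_ hδ fun y hy => hb x y hx1 hx0 hy
    refine continuous_iff_continuousAt.2 fun y => ?_
    refine ContinuousAt.comp (f := fun y : ℝ => (x : ℂ) + y * I) (g := f)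
      (hd _ (by simpa using hx1) (by simpa using hx0) fun hm => ?_).continuousAt (by fun_prop)
    have := hS _ hm
    rcases hx' with rfl | rfl <;> simp at this
  have hlim : ∀ x : ℝ, x = x₁ ∨ x = x₀ → Tendsto (fun T : ℝ => ∫ y in (-T)..T, f (x + y * I))
      atTop (𝓝 (∫ y : ℝ, f (x + y * I))) := fun x hx' =>
    intervalIntegral_tendsto_integral (hint x hx') tendsto_neg_atTop_atBot tendsto_id
  have hexp : Tendsto (fun T : ℝ => C * Real.exp (-δ * T) * |x₀ - x₁|) atTop (𝓝 0) := by
    have : Tendsto (fun T : ℝ => Real.exp (-δ * T)) atTop (𝓝 0) :=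
      Real.tendsto_exp_atBot.comp (tendsto_id.const_mul_atTop_of_neg (by linarith))
    simpa using (this.const_mul C).mul_const |x₀ - x₁|
  have hhor : ∀ e : ℝ, |e| = 1 → Tendsto (fun T : ℝ => ∫ x in x₁..x₀, f (x + (e * T : ℝ) * I))
      atTop (𝓝 0) := by
    intro e he
    refine squeeze_zero_norm' ?_ hexp
    filter_upwards [eventually_ge_atTop Y, eventually_ge_atTop 0] with T hT hT0
    refine intervalIntegral.norm_integral_le_of_norm_le_const fun x hx' => ?_
    rw [uIoc_of_le hx] at hx'
    have habs : |e * T| = T := by rw [abs_mul, he, one_mul, abs_of_nonneg hT0]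
    have := hb x (e * T) hx'.1.le hx'.2 (by rw [habs]; exact hT)
    rwa [habs] at this
  have hrect : Tendsto (fun T : ℝ => rectIntegral f x₁ x₀ T) atTop
      (𝓝 (0 - 0 + I * (∫ y : ℝ, f (x₀ + y * I)) - I * (∫ y : ℝ, f (x₁ + y * I)))) := by
    have h1 := hhor (-1) (by simp)
    have h2 := hhor 1 (by simp)
    simp only [neg_mul, one_mul] at h1 h2
    exact ((h1.sub h2).add ((hlim x₀ (Or.inr rfl)).const_mul I)).sub
      ((hlim x₁ (Or.inl rfl)).const_mul I)
  have hconst : Tendsto (fun T : ℝ => rectIntegral f x₁ x₀ T) atTop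
      (𝓝 (2 * Real.pi * I * ∑ p ∈ S, r p)) := by
    refine tendsto_const_nhds.congr' ?_
    have hfin : ∀ᶠ T : ℝ in atTop, ∀ p ∈ S, |p.im| < T :=
      (Finset.eventually_all S).2 fun p _ => eventually_gt_atTop _
    filter_upwards [hfin, eventually_ge_atTop 0] with T hT hT0
    exact (rectIntegral_eq_sum_residues S f r x₁ x₀ T
      (fun p hp => ⟨(hS p hp).1, (hS p hp).2, hT p hp⟩) hx hT0 hd hr).symm
  have := tendsto_nhds_unique hrect hconst
  refine mul_left_cancel₀ I_ne_zero ?_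
  linear_combination this

lemma norm_Gamma_le_Gamma_re {z : ℂ} (hz : 0 < z.re) : ‖Gamma z‖ ≤ Real.Gamma z.re := by
  rw [Gamma_eq_integral hz, Real.Gamma_eq_integral hz, GammaIntegral]
  refine (norm_integral_le_integral_norm _).trans (le_of_eq ?_)
  refine setIntegral_congr_fun measurableSet_Ioi fun x hx => ?_
  simp only [norm_mul, norm_real, Real.norm_eq_abs, Real.abs_exp]
  rw [norm_cpow_eq_rpow_re_of_pos hx]
  simp

lemma norm_betaIntegral_le {u v : ℂ} (hu : 0 < u.re) (hv : 0 < v.re) :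
    ‖betaIntegral u v‖ ≤ Real.Gamma u.re * Real.Gamma v.re / Real.Gamma (u.re + v.re) := by
  have h := betaIntegral_eq_Gamma_mul_div (u.re : ℂ) (v.re : ℂ) (by simpa) (by simpa)
  rw [← ofReal_add, Gamma_ofReal, Gamma_ofReal, Gamma_ofReal] at h
  have h2 : betaIntegral (u.re : ℂ) (v.re : ℂ) =
      ((∫ x : ℝ in (0 : ℝ)..1, ‖(x : ℂ) ^ (u - 1) * (1 - (x : ℂ)) ^ (v - 1)‖ : ℝ) : ℂ) := by
    rw [betaIntegral, ← intervalIntegral.integral_ofReal]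
    refine intervalIntegral.integral_congr_ae ?_
    have h1 : ∀ᵐ x : ℝ, x ≠ 1 := by simp [ae_iff]
    filter_upwards [h1] with x hx1 hx
    rw [uIoc_of_le zero_le_one] at hx
    have hx' : 0 < 1 - x := sub_pos.2 (lt_of_le_of_ne hx.2 hx1)
    have e : 1 - (x : ℂ) = ((1 - x : ℝ) : ℂ) := by push_cast; rfl
    rw [e, norm_mul, norm_cpow_eq_rpow_re_of_pos hx.1, norm_cpow_eq_rpow_re_of_pos hx', ofReal_mul, ofReal_cpow hx.1.le, ofReal_cpow hx'.le]
    simp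
  have h3 : (∫ x : ℝ in (0 : ℝ)..1, ‖(x : ℂ) ^ (u - 1) * (1 - (x : ℂ)) ^ (v - 1)‖) =
      Real.Gamma u.re * Real.Gamma v.re / Real.Gamma (u.re + v.re) := by
    have := h2.symm.trans h
    exact_mod_cast this
  rw [← h3, betaIntegral]
  exact intervalIntegral.norm_integral_le_integral_norm zero_le_one

/-- Quotients `Γ(u) / Γ(u + v)` are dominated by their values on the real axis. -/
lemma norm_Gamma_mul_inv_Gamma_add_le {u v : ℂ} (hu : 0 < u.re) (hv : 0 < v.re) :
    ‖Gamma u * (Gamma (u + v))⁻¹‖ ≤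
      Real.Gamma u.re * Real.Gamma v.re / Real.Gamma (u.re + v.re) * ‖(Gamma v)⁻¹‖ := by
  have hv0 := Gamma_ne_zero_of_re_pos hv
  have : Gamma u * (Gamma (u + v))⁻¹ = betaIntegral u v * (Gamma v)⁻¹ := by
    rw [betaIntegral_eq_Gamma_mul_div u v hu hv]
    field_simp
  rw [this, norm_mul]
  exact mul_le_mul_of_nonneg_right (norm_betaIntegral_le hu hv) (norm_nonneg _)

lemma Real.cosh_le_exp_abs (x : ℝ) : Real.cosh x ≤ Real.exp |x| := by
  rw [Real.cosh_eq]
  have h1 := Real.exp_le_exp.2 (le_abs_self x)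
  have h2 := Real.exp_le_exp.2 (neg_le_abs x)
  linarith

lemma norm_Gamma_half_add (y : ℝ) :
    ‖Gamma (1 / 2 + y * I)‖ ^ 2 = Real.pi / Real.cosh (Real.pi * y) := by
  have h := Gamma_mul_Gamma_one_sub (1 / 2 + y * I)
  have hc : (1 : ℂ) - (1 / 2 + y * I) = (starRingEnd ℂ) (1 / 2 + y * I) := by
    apply Complex.ext <;> norm_num
  rw [hc, Gamma_conj, mul_conj, normSq_eq_norm_sq] at h
  have hs : sin ((Real.pi : ℂ) * (1 / 2 + y * I)) = (Real.cosh (Real.pi * y) : ℂ) := by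
    rw [mul_add, show (Real.pi : ℂ) * (1 / 2) = Real.pi / 2 by ring, add_comm, sin_add_pi_div_two,
      ← mul_assoc, cos_mul_I]
    push_cast
    rfl
  rw [hs] at h
  exact_mod_cast h

lemma norm_GammaSeq_mul_le (σ y : ℝ) (hσ : 1 / 2 ≤ σ) (n : ℕ) (hn : n ≠ 0) :
    ‖GammaSeq (1 / 2 + y * I) n‖ * Real.GammaSeq σ n ≤
      ‖GammaSeq (σ + y * I) n‖ * Real.GammaSeq (1 / 2) n := by
  have hn' : 0 < n := Nat.pos_of_ne_zero hn
  have hne : ∀ (x : ℝ), 1 / 2 ≤ x → ∀ j : ℕ, 0 < ‖(x : ℂ) + y * I + j‖ := fun x hx j => by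
    rw [norm_pos_iff]
    intro h
    have := congrArg re h
    simp at this
    have := Nat.cast_nonneg (α := ℝ) j
    linarith
  have hprod : ∏ j ∈ Finset.range (n + 1), ‖(σ : ℂ) + y * I + j‖ * (1 / 2 + j : ℝ) ≤
      ∏ j ∈ Finset.range (n + 1), ‖((1 / 2 : ℝ) : ℂ) + y * I + j‖ * (σ + j) := by
    refine Finset.prod_le_prod (fun j _ => by positivity) fun j _ => ?_
    have hj := Nat.cast_nonneg (α := ℝ) j
    refine (sq_le_sq₀ (by positivity) (by positivity)).1 ?_
    have e : ∀ x : ℝ, ‖(x : ℂ) + y * I + j‖ ^ 2 = (x + j) ^ 2 + y ^ 2 := fun x => by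
      rw [← normSq_eq_norm_sq, normSq_apply]; simp; ring
    rw [mul_pow, mul_pow, e, e]
    have h1 : (1 / 2 + (j : ℝ)) ^ 2 ≤ (σ + j) ^ 2 := by gcongr
    nlinarith [sq_nonneg y, mul_le_mul_of_nonneg_left h1 (sq_nonneg y)]
  have hnorm : ∀ x : ℝ, ‖GammaSeq (x + y * I) n‖ =
      (n : ℝ) ^ x * n.factorial / ∏ j ∈ Finset.range (n + 1), ‖(x : ℂ) + y * I + j‖ := fun x => by
    rw [GammaSeq, norm_div, norm_mul, norm_prod, norm_natCast_cpow_of_pos hn']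
    simp
  have e1 := hnorm σ
  have e2 := hnorm (1 / 2)
  rw [show (((1 / 2 : ℝ) : ℂ)) = 1 / 2 by norm_num] at e2 hprod
  rw [e1, e2, Real.GammaSeq, Real.GammaSeq, div_mul_div_comm, div_mul_div_comm,
    ← Finset.prod_mul_distrib, ← Finset.prod_mul_distrib]
  rw [show (n : ℝ) ^ (1 / 2 : ℝ) * n.factorial * ((n : ℝ) ^ σ * n.factorial) =
    (n : ℝ) ^ σ * n.factorial * ((n : ℝ) ^ (1 / 2 : ℝ) * n.factorial) by ring]
  refine div_le_div_of_nonneg_left (by positivity) ?_ hprod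
  exact Finset.prod_pos fun j _ => mul_pos (hne σ hσ j) (by positivity)

/-- A lower bound for `Γ` in the half-plane `Re z ≥ 1/2`. -/
lemma norm_inv_Gamma_le {z : ℂ} (hz : 1 / 2 ≤ z.re) :
    ‖(Gamma z)⁻¹‖ ≤ Real.exp (Real.pi / 2 * |z.im|) / Real.Gamma z.re := by
  have hlim : ‖Gamma (1 / 2 + z.im * I)‖ * Real.Gamma z.re ≤ ‖Gamma z‖ * Real.Gamma (1 / 2) := by
    have h1 := ((GammaSeq_tendsto_Gamma (1 / 2 + z.im * I)).norm).mul
      (Real.GammaSeq_tendsto_Gamma z.re)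
    have h2 := ((GammaSeq_tendsto_Gamma (z.re + z.im * I)).norm).mul
      (Real.GammaSeq_tendsto_Gamma (1 / 2))
    have := le_of_tendsto_of_tendsto h1 h2 (by
      filter_upwards [eventually_ne_atTop 0] with n hn
      exact norm_GammaSeq_mul_le z.re z.im hz n hn)
    rwa [re_add_im] at this
  have hG : 0 < Real.Gamma z.re := Real.Gamma_pos_of_pos (by linarith)
  have hGz : 0 < ‖Gamma z‖ := norm_pos_iff.2 (Gamma_ne_zero_of_re_pos (by linarith))
  rw [Real.Gamma_one_half_eq] at hlim
  have hlow : Real.sqrt Real.pi ≤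
      ‖Gamma (1 / 2 + z.im * I)‖ * Real.exp (Real.pi / 2 * |z.im|) := by
    refine Real.sqrt_le_iff.2 ⟨by positivity, ?_⟩
    rw [mul_pow, norm_Gamma_half_add, ← Real.exp_nat_mul]
    have hc := Real.cosh_le_exp_abs (Real.pi * z.im)
    rw [abs_mul, abs_of_pos Real.pi_pos] at hc
    have : Real.exp ((2 : ℕ) * (Real.pi / 2 * |z.im|)) = Real.exp (Real.pi * |z.im|) := by
      congr 1; push_cast; ring
    rw [this, div_mul_eq_mul_div, le_div_iff₀ (Real.cosh_pos _)]
    exact mul_le_mul_of_nonneg_left hc Real.pi_pos.le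
  rw [norm_inv, inv_eq_one_div, div_le_div_iff₀ hGz hG, one_mul]
  have hpi : 0 < Real.sqrt Real.pi := Real.sqrt_pos.2 Real.pi_pos
  refine le_of_mul_le_mul_left ?_ hpi
  calc Real.sqrt Real.pi * Real.Gamma z.re
      ≤ ‖Gamma (1 / 2 + z.im * I)‖ * Real.exp (Real.pi / 2 * |z.im|) * Real.Gamma z.re := by gcongr
    _ = ‖Gamma (1 / 2 + z.im * I)‖ * Real.Gamma z.re * Real.exp (Real.pi / 2 * |z.im|) := by ring
    _ ≤ ‖Gamma z‖ * Real.sqrt Real.pi * Real.exp (Real.pi / 2 * |z.im|) := by gcongr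
    _ = _ := by ring

lemma Real.prod_range_add_eq_Gamma_div {σ : ℝ} (hσ : 0 < σ) (n : ℕ) :
    Real.Gamma σ * ∏ j ∈ Finset.range n, (σ + j) = Real.Gamma (σ + n) := by
  induction n with
  | zero => simp
  | succ n ih =>
    rw [Finset.prod_range_succ, ← mul_assoc, ih, Nat.cast_succ, ← add_assoc,
      Real.Gamma_add_one (by positivity), mul_comm]

/-- `Γ(σ + N)` is comparable to `N! (N + 1)^(σ - 1)`. -/
lemma Real.exists_Gamma_add_nat_bounds {σ : ℝ} (hσ : 0 < σ) : ∃ C : ℝ, 0 < C ∧ ∀ N : ℕ,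
    Real.Gamma (σ + N) ≤ C * (N.factorial * ((N : ℝ) + 1) ^ (σ - 1)) ∧
    N.factorial * ((N : ℝ) + 1) ^ (σ - 1) ≤ C * Real.Gamma (σ + N) := by
  set w : ℕ → ℝ := fun N => N.factorial * ((N : ℝ) + 1) ^ (σ - 1) / Real.Gamma (σ + N) with hw
  have hG : ∀ N : ℕ, 0 < Real.Gamma (σ + N) := fun N => Real.Gamma_pos_of_pos (by positivity)
  have hG0 := Real.Gamma_pos_of_pos hσ
  have hwpos : ∀ N, 0 < w N := fun N => div_pos (by positivity) (hG N)
  have hlim : Tendsto w atTop (𝓝 1) := by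
    have h1 := ((Real.GammaSeq_tendsto_Gamma σ).comp (tendsto_add_atTop_nat 1)).div_const
      (Real.Gamma σ)
    have h2 : ∀ a : ℝ, Tendsto (fun N : ℕ => (a + N) / ((N : ℝ) + 1)) atTop (𝓝 1) := fun a => by
      have h := (tendsto_one_div_add_atTop_nhds_zero_nat (𝕜 := ℝ)).const_mul (a - 1)
      have h := h.const_add 1
      simp only [mul_zero, add_zero] at h
      refine h.congr fun N => ?_
      field_simp
      ring
    have h3 := (h1.mul (h2 σ)).mul (h2 (σ + 1))
    rw [div_self hG0.ne', one_mul, one_mul] at h3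
    refine h3.congr fun N => ?_
    have hp := Real.prod_range_add_eq_Gamma_div hσ (N + 2)
    have hg1 : Real.Gamma (σ + (N + 2 : ℕ)) = (σ + N + 1) * ((σ + N) * Real.Gamma (σ + N)) := by
      rw [← Real.Gamma_add_one (by positivity), ← Real.Gamma_add_one (by positivity)]
      congr 1; push_cast; ring
    rw [hg1] at hp
    have hP : 0 < ∏ j ∈ Finset.range (N + 2), (σ + j) := Finset.prod_pos fun j _ => by positivity
    simp only [Function.comp, Real.GammaSeq, hw]
    rw [Real.rpow_sub_one (by positivity), Nat.factorial_succ]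
    have hGN := hG N
    push_cast
    rw [show N + 1 + 1 = N + 2 by ring]
    generalize (∏ j ∈ Finset.range (N + 2), (σ + (j : ℝ))) = P at *
    generalize Real.Gamma (σ + N) = g at *
    have hPe : P = (σ + N + 1) * ((σ + N) * g) / Real.Gamma σ := by
      rw [eq_div_iff hG0.ne', mul_comm]; exact hp
    have : 0 < σ + N := by positivity
    rw [hPe]
    field_simp
    ring
  obtain ⟨B, hB⟩ := hlim.bddAbove_range
  obtain ⟨B', hB'⟩ := (hlim.inv₀ one_ne_zero).bddAbove_range
  refine ⟨max 1 (max B B'), by positivity, fun N => ⟨?_, ?_⟩⟩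
  · have h := hB' ⟨N, rfl⟩
    simp only [hw, inv_div] at h
    rw [div_le_iff₀ (by positivity)] at h
    refine h.trans ?_
    gcongr
    exact (le_max_right _ _).trans (le_max_right _ _)
  · have h := hB ⟨N, rfl⟩
    simp only [hw] at h
    rw [div_le_iff₀ (hG N)] at h
    refine h.trans (mul_le_mul_of_nonneg_right ?_ (hG N).le)
    exact (le_max_left _ _).trans (le_max_right _ _)

/-- `‖f N t‖ ≪ (N!)^j (N + 1)^p exp(κ|t|)`, uniformly in `N` and `t`. -/
def GrowthBound (f : ℕ → ℝ → ℂ) (j : ℤ) (p κ : ℝ) : Prop :=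
  ∃ C : ℝ, 0 ≤ C ∧ ∀ (N : ℕ) (t : ℝ),
    ‖f N t‖ ≤ C * ((N.factorial : ℝ) ^ j * ((N : ℝ) + 1) ^ p * Real.exp (κ * |t|))

namespace GrowthBound

variable {f g : ℕ → ℝ → ℂ} {j k : ℤ} {p q κ l : ℝ}

lemma mul (hf : GrowthBound f j p κ) (hg : GrowthBound g k q l) :
    GrowthBound (fun N t => f N t * g N t) (j + k) (p + q) (κ + l) := by
  obtain ⟨C, hC, hf⟩ := hf
  obtain ⟨D, hD, hg⟩ := hg
  refine ⟨C * D, by positivity, fun N t => ?_⟩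
  have h0 : (N.factorial : ℝ) ≠ 0 := by positivity
  rw [norm_mul, zpow_add₀ h0, Real.rpow_add (by positivity), add_mul, Real.exp_add]
  calc ‖f N t‖ * ‖g N t‖ ≤ _ := mul_le_mul (hf N t) (hg N t) (norm_nonneg _) (by positivity)
    _ = _ := by ring

lemma mono (hf : GrowthBound f j p κ) (h : κ ≤ l) : GrowthBound f j p l := by
  obtain ⟨C, hC, hf⟩ := hf
  refine ⟨C, hC, fun N t => (hf N t).trans ?_⟩
  gcongr

lemma congr (hf : GrowthBound f j p κ) (h : ∀ N t, g N t = f N t) (hj : j = k) (hp : p = q)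
    (hκ : κ ≤ l) : GrowthBound g k q l := by
  subst hj hp
  obtain ⟨C, hC, hf⟩ := hf.mono hκ
  exact ⟨C, hC, fun N t => (h N t) ▸ hf N t⟩

lemma of_bound {u : ℝ → ℂ} {C : ℝ} (h : ∀ t, ‖u t‖ ≤ C * Real.exp (κ * |t|)) :
    GrowthBound (fun _ t => u t) 0 0 κ := by
  refine ⟨|C|, abs_nonneg _, fun N t => (h t).trans ?_⟩
  simp only [zpow_zero, Real.rpow_zero, one_mul]
  gcongr
  exact le_abs_self C

lemma const (c : ℂ) : GrowthBound (fun _ _ => c) 0 0 0 :=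
  of_bound (C := ‖c‖) fun t => by simp

lemma bound_of_const {u : ℝ → ℂ} (h : GrowthBound (fun _ t => u t) j p κ) :
    ∃ C : ℝ, 0 ≤ C ∧ ∀ t, ‖u t‖ ≤ C * Real.exp (κ * |t|) := by
  obtain ⟨C, hC, h⟩ := h
  exact ⟨C, hC, fun t => by simpa using h 0 t⟩

end GrowthBound

lemma exists_add_le_mul_exp (a : ℝ) {ε : ℝ} (hε : 0 < ε) :
    ∃ C : ℝ, 0 ≤ C ∧ ∀ y : ℝ, 0 ≤ y → a + y ≤ C * Real.exp (ε * y) := by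
  refine ⟨|a| + 1 / ε, by positivity, fun y hy => ?_⟩
  have h1 := Real.add_one_le_exp (ε * y)
  have h2 : 1 ≤ Real.exp (ε * y) := Real.one_le_exp (by positivity)
  have h3 : y ≤ 1 / ε * Real.exp (ε * y) := by
    rw [div_mul_eq_mul_div, one_mul, le_div_iff₀ hε]
    linarith
  nlinarith [le_abs_self a, mul_le_mul_of_nonneg_left h2 (abs_nonneg a)]

lemma exp_mul_le_of_le {κ y t l m : ℝ} (hκ : 0 ≤ κ) (h : y ≤ l * t + m) :
    Real.exp (κ * y) ≤ Real.exp (κ * m) * Real.exp (l * κ * t) := by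
  rw [← Real.exp_add]
  refine Real.exp_le_exp.2 ?_
  nlinarith [mul_le_mul_of_nonneg_left h hκ]

lemma growthBound_Gamma (z : ℝ → ℂ) {σ : ℝ} (hσ : 0 < σ) (hz : ∀ t, (z t).re = σ) :
    GrowthBound (fun N t => Gamma (z t + N)) 1 (σ - 1) 0 := by
  obtain ⟨C, hC, h⟩ := Real.exists_Gamma_add_nat_bounds hσ
  refine ⟨C, hC.le, fun N t => ?_⟩
  have hre : (z t + N).re = σ + N := by simp [hz]
  have := norm_Gamma_le_Gamma_re (z := z t + N) (by rw [hre]; positivity)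
  rw [hre] at this
  simpa using this.trans (h N).1

lemma growthBound_inv_Gamma_of_half_le (z : ℝ → ℂ) {σ l m ε : ℝ} (hσ : 1 / 2 ≤ σ) (hε : 0 ≤ ε)
    (hl : 0 ≤ l) (hz : ∀ t, (z t).re = σ) (hi : ∀ t, |(z t).im| ≤ l * |t| + m) :
    GrowthBound (fun N t => (Gamma (z t + N))⁻¹) (-1) (1 - σ) (l * (Real.pi / 2 + ε)) := by
  have hσ0 : 0 < σ := by linarith
  obtain ⟨C, hC, h⟩ := Real.exists_Gamma_add_nat_bounds hσ0
  refine GrowthBound.mono (κ := l * (Real.pi / 2)) ⟨C * Real.exp (Real.pi / 2 * m), by positivity,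
    fun N t => ?_⟩ (by gcongr; linarith)
  have hre : (z t + N).re = σ + N := by simp [hz]
  have him : (z t + N).im = (z t).im := by simp
  have h1 := norm_inv_Gamma_le (z := z t + N) (by rw [hre]; have := Nat.cast_nonneg (α := ℝ) N; linarith)
  rw [hre, him] at h1
  have hG : 0 < Real.Gamma (σ + N) := Real.Gamma_pos_of_pos (by positivity)
  have h2 : (Real.Gamma (σ + N))⁻¹ ≤ C * ((N.factorial : ℝ) ^ (-1 : ℤ) * ((N : ℝ) + 1) ^ (1 - σ)) := by
    rw [show (1 - σ) = -(σ - 1) by ring, Real.rpow_neg (by positivity), zpow_neg_one, ← mul_inv,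
      ← div_eq_mul_inv, le_div_iff₀ (by positivity), ← div_eq_inv_mul, div_le_iff₀ hG]
    exact (h N).2
  have h3 := exp_mul_le_of_le (κ := Real.pi / 2) (by positivity) (hi t)
  calc _ ≤ _ := h1
    _ ≤ (Real.exp (Real.pi / 2 * m) * Real.exp (l * (Real.pi / 2) * |t|)) *
        (C * ((N.factorial : ℝ) ^ (-1 : ℤ) * ((N : ℝ) + 1) ^ (1 - σ))) := by
      rw [div_eq_mul_inv]
      exact mul_le_mul h3 h2 (inv_nonneg.2 hG.le) (by positivity)
    _ = _ := by ring

lemma growthBound_inv_Gamma (z : ℝ → ℂ) {σ l m ε : ℝ} (hε : 0 < ε)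
    (hl : 0 ≤ l) (hz : ∀ t, (z t).re = σ) (hi : ∀ t, |(z t).im| ≤ l * |t| + m) :
    GrowthBound (fun N t => (Gamma (z t + N))⁻¹) (-1) (1 - σ) (l * (Real.pi / 2 + ε)) := by
  obtain ⟨k, hk⟩ := exists_nat_ge (1 / 2 - σ)
  induction k generalizing z σ ε with
  | zero => exact growthBound_inv_Gamma_of_half_le z (by simp at hk; linarith) hε.le hl hz hi
  | succ k ih =>
    have h1 := ih (fun t => z t + 1) (σ := σ + 1) (half_pos hε) (fun t => by simp [hz])
      (fun t => by simpa using hi t) (by push_cast at hk; linarith)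
    have h2 : GrowthBound (fun N t => z t + N) 0 1 (l * (ε / 2)) := by
      obtain ⟨C, hC, hC'⟩ := exists_add_le_mul_exp (|σ| + 1) (half_pos hε)
      refine ⟨C * Real.exp (ε / 2 * m), by positivity, fun N t => ?_⟩
      have hN := Nat.cast_nonneg (α := ℝ) N
      have hn : ‖z t + N‖ ≤ |σ| + N + |(z t).im| := by
        refine (norm_le_abs_re_add_abs_im _).trans ?_
        simp only [add_re, natCast_re, add_im, natCast_im, add_zero, hz]
        gcongr
        exact (abs_add_le _ _).trans (by simp)
      have hy := hC' _ (abs_nonneg (z t).im)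
      have h3 := exp_mul_le_of_le (κ := ε / 2) (by positivity) (hi t)
      simp only [zpow_zero, one_mul, Real.rpow_one]
      calc ‖z t + N‖ ≤ (N + 1) * (|σ| + 1 + |(z t).im|) := by
            nlinarith [abs_nonneg σ, abs_nonneg (z t).im]
        _ ≤ (N + 1) * (C * (Real.exp (ε / 2 * m) * Real.exp (l * (ε / 2) * |t|))) := by
            gcongr
            exact hy.trans (by gcongr)
        _ = _ := by ring
    refine (h2.mul h1).congr (fun N t => ?_) (by ring) (by ring) (by linarith)
    rw [one_div_Gamma_eq_self_mul_one_div_Gamma_add_one, add_right_comm]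

lemma growthBound_Gamma_mul_inv_Gamma_add (z d : ℝ → ℂ) {σ τ l m ε : ℝ} (hε : 0 < ε)
    (hl : 0 ≤ l) (hσ : 0 < σ) (hτ : 0 < τ) (hz : ∀ t, (z t).re = σ) (hd : ∀ t, (d t).re = τ)
    (hi : ∀ t, |(d t).im| ≤ l * |t| + m) :
    GrowthBound (fun N t => Gamma (z t + N) * (Gamma (z t + d t + N))⁻¹) 0 (-τ)
      (l * (Real.pi / 2 + ε)) := by
  obtain ⟨A, hA, hA'⟩ := growthBound_inv_Gamma d hε hl hd hi
  obtain ⟨C, hC, h⟩ := Real.exists_Gamma_add_nat_bounds hσ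
  obtain ⟨D, hD, h'⟩ := Real.exists_Gamma_add_nat_bounds (add_pos hσ hτ)
  have hGτ := Real.Gamma_pos_of_pos hτ
  refine ⟨C * Real.Gamma τ * D * A, by positivity, fun N t => ?_⟩
  have h1 := norm_Gamma_mul_inv_Gamma_add_le (u := z t + N) (v := d t) (by simp [hz]; positivity)
    (by rw [hd]; exact hτ)
  have hre : (z t + N).re = σ + N := by simp [hz]
  rw [hre, hd, show z t + N + d t = z t + d t + N by ring] at h1
  have hA0 := hA' 0 t
  simp only [Nat.factorial_zero, Nat.cast_one, one_zpow, Nat.cast_zero, zero_add, Real.one_rpow,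
    one_mul, add_zero] at hA0
  have hG : 0 < Real.Gamma (σ + N + τ) := Real.Gamma_pos_of_pos (by positivity)
  have h2 : Real.Gamma (σ + N) / Real.Gamma (σ + N + τ) ≤ C * D * ((N : ℝ) + 1) ^ (-τ) := by
    rw [div_le_iff₀ hG]
    refine (h N).1.trans ?_
    have h3 := (h' N).2
    rw [show σ + τ + N = σ + N + τ by ring] at h3
    have h4 : ((N : ℝ) + 1) ^ (σ - 1) = ((N : ℝ) + 1) ^ (σ + τ - 1) * ((N : ℝ) + 1) ^ (-τ) := by
      rw [← Real.rpow_add (by positivity)]; congr 1; ring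
    rw [h4]
    calc C * (N.factorial * (((N : ℝ) + 1) ^ (σ + τ - 1) * ((N : ℝ) + 1) ^ (-τ)))
        = C * ((N : ℝ) + 1) ^ (-τ) * (N.factorial * ((N : ℝ) + 1) ^ (σ + τ - 1)) := by ring
      _ ≤ C * ((N : ℝ) + 1) ^ (-τ) * (D * Real.Gamma (σ + N + τ)) := by gcongr
      _ = _ := by ring
  calc _ ≤ _ := h1
    _ = Real.Gamma (σ + N) / Real.Gamma (σ + N + τ) * Real.Gamma τ * ‖(Gamma (d t))⁻¹‖ := by ring
    _ ≤ C * D * ((N : ℝ) + 1) ^ (-τ) * Real.Gamma τ *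
        (A * Real.exp (l * (Real.pi / 2 + ε) * |t|)) := by gcongr
    _ = _ := by rw [zpow_zero]; ring

lemma exists_norm_inv_Gamma_le (A B : ℝ) {ε : ℝ} (hε : 0 < ε) : ∃ C : ℝ, 0 ≤ C ∧ ∀ z : ℂ,
    A ≤ z.re → z.re ≤ B → ‖(Gamma z)⁻¹‖ ≤ C * Real.exp ((Real.pi / 2 + ε) * |z.im|) := by
  obtain ⟨k, hk⟩ := exists_nat_ge (1 / 2 - A)
  induction k generalizing A B ε with
  | zero =>
    simp at hk
    have hcont : ContinuousOn (fun x => (Real.Gamma x)⁻¹) (Icc A B) := by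
      intro x hx
      have hx0 : 0 < x := by linarith [hx.1]
      exact ((Real.differentiableAt_Gamma fun m h => by
        have := Nat.cast_nonneg (α := ℝ) m; linarith).continuousAt.inv₀
          (Real.Gamma_pos_of_pos hx0).ne').continuousWithinAt
    obtain ⟨C, hC⟩ := isCompact_Icc.exists_bound_of_continuousOn hcont
    refine ⟨|C|, abs_nonneg _, fun z h1 h2 => (norm_inv_Gamma_le (by linarith)).trans ?_⟩
    have h3 := (le_abs_self _).trans ((hC z.re ⟨h1, h2⟩).trans (le_abs_self C))
    rw [div_eq_mul_inv, mul_comm]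
    gcongr
    linarith
  | succ k ih =>
    obtain ⟨C, hC, h⟩ := ih (A + 1) (B + 1) (half_pos hε) (by push_cast at hk; linarith)
    obtain ⟨D, hD, hD'⟩ := exists_add_le_mul_exp (|A| + |B|) (half_pos hε)
    refine ⟨D * C, by positivity, fun z h1 h2 => ?_⟩
    have h3 := h (z + 1) (by simpa using h1) (by simpa using h2)
    rw [one_div_Gamma_eq_self_mul_one_div_Gamma_add_one, norm_mul]
    simp only [add_im, one_im, add_zero] at h3
    have h4 : ‖z‖ ≤ |A| + |B| + |z.im| := by
      refine (norm_le_abs_re_add_abs_im z).trans ?_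
      gcongr
      refine abs_le.2 ⟨?_, ?_⟩
      · linarith [neg_abs_le A, abs_nonneg B]
      · linarith [le_abs_self B, abs_nonneg A]
    calc ‖z‖ * ‖(Gamma (z + 1))⁻¹‖ ≤ (D * Real.exp (ε / 2 * |z.im|)) *
          (C * Real.exp ((Real.pi / 2 + ε / 2) * |z.im|)) :=
          mul_le_mul (h4.trans (hD' _ (abs_nonneg _))) h3 (norm_nonneg _) (by positivity)
      _ = D * C * (Real.exp (ε / 2 * |z.im|) * Real.exp ((Real.pi / 2 + ε / 2) * |z.im|)) := by ring
      _ = _ := by rw [← Real.exp_add]; congr 2; ring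

lemma normSq_sin (x y : ℝ) :
    ‖sin (x + y * I)‖ ^ 2 = Real.sin x ^ 2 + Real.sinh y ^ 2 := by
  rw [sin_add_mul_I, ← normSq_eq_norm_sq, ← ofReal_sin, ← ofReal_cos, ← ofReal_cosh,
    ← ofReal_sinh, normSq_apply]
  simp only [add_re, mul_re, ofReal_re, ofReal_im, I_re, I_im, add_im, mul_im]
  nlinarith [Real.sin_sq_add_cos_sq x, Real.cosh_sq y]

lemma abs_sin_mul_cosh_le (x y : ℝ) : |Real.sin x| * Real.cosh y ≤ ‖sin (x + y * I)‖ := by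
  refine (sq_le_sq₀ (by positivity) (norm_nonneg _)).1 ?_
  rw [normSq_sin, mul_pow, sq_abs, Real.cosh_sq]
  nlinarith [Real.sin_sq_le_one x, sq_nonneg (Real.sinh y)]

lemma abs_sinh_le (x y : ℝ) : |Real.sinh y| ≤ ‖sin (x + y * I)‖ := by
  refine (sq_le_sq₀ (by positivity) (norm_nonneg _)).1 ?_
  rw [normSq_sin, sq_abs]
  nlinarith [sq_nonneg (Real.sin x)]

lemma exp_abs_le_two_mul_cosh (y : ℝ) : Real.exp |y| ≤ 2 * Real.cosh y := by
  rw [← Real.cosh_abs, Real.cosh_eq]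
  linarith [Real.exp_pos (-|y|)]

lemma exp_abs_le_four_mul_abs_sinh {y : ℝ} (hy : 1 ≤ |y|) : Real.exp |y| ≤ 4 * |Real.sinh y| := by
  have h : |Real.sinh y| = Real.sinh |y| := by rw [Real.abs_sinh]
  rw [h, Real.sinh_eq]
  have h1 := Real.add_one_le_exp |y|
  have h2 : Real.exp (-|y|) ≤ 1 := Real.exp_le_one_iff.2 (by linarith)
  linarith

/-- Exponential decay of `Γ` in vertical strips. -/
lemma exists_norm_Gamma_le (A B : ℝ) {ε : ℝ} (hε : 0 < ε) : ∃ C : ℝ, 0 ≤ C ∧ ∀ z : ℂ,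
    A ≤ z.re → z.re ≤ B → 1 ≤ |z.im| →
      ‖Gamma z‖ ≤ C * Real.exp (-(Real.pi / 2 - ε) * |z.im|) := by
  obtain ⟨C, hC, h⟩ := exists_norm_inv_Gamma_le (1 - B) (1 - A) hε
  refine ⟨4 * Real.pi * C, by positivity, fun z h1 h2 hy => ?_⟩
  have h3 := h (1 - z) (by simp; linarith) (by simp; linarith)
  have hpy : 1 ≤ |Real.pi * z.im| := by
    rw [abs_mul, abs_of_pos Real.pi_pos]
    nlinarith [Real.pi_gt_three]
  have hne : Gamma (1 - z) ≠ 0 := by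
    rw [Ne, Gamma_eq_zero_iff]
    rintro ⟨m, hm⟩
    have := congrArg im hm
    simp at this
    rw [this] at hy
    norm_num at hy
  have hG : Gamma z = Real.pi / sin (Real.pi * z) * (Gamma (1 - z))⁻¹ := by
    rw [← Gamma_mul_Gamma_one_sub, mul_assoc, mul_inv_cancel₀ hne, mul_one]
  have hz : (Real.pi : ℂ) * z = ((Real.pi * z.re : ℝ) : ℂ) + ((Real.pi * z.im : ℝ) : ℂ) * I := by
    conv_lhs => rw [← re_add_im z]
    push_cast; ring
  have h4 := abs_sinh_le (Real.pi * z.re) (Real.pi * z.im)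
  have h5 := exp_abs_le_four_mul_abs_sinh hpy
  rw [abs_mul Real.pi, abs_of_pos Real.pi_pos] at h5
  rw [← hz] at h4
  simp only [sub_im, one_im, zero_sub, abs_neg] at h3
  have h6 : ‖(Real.pi : ℂ) / sin (Real.pi * z)‖ ≤ 4 * Real.pi * Real.exp (-(Real.pi * |z.im|)) := by
    rw [norm_div, norm_real, Real.norm_of_nonneg Real.pi_pos.le, Real.exp_neg, ← div_eq_mul_inv,
      div_le_div_iff₀ (by linarith [Real.exp_pos (Real.pi * |z.im|)]) (Real.exp_pos _)]
    nlinarith [Real.pi_pos]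
  rw [hG, norm_mul]
  calc _ ≤ _ := mul_le_mul h6 h3 (norm_nonneg _) (by positivity)
    _ = 4 * Real.pi * C * (Real.exp (-(Real.pi * |z.im|)) *
        Real.exp ((Real.pi / 2 + ε) * |z.im|)) := by ring
    _ = _ := by rw [← Real.exp_add]; congr 2; ring

lemma growthBound_Gamma_decay (z : ℝ → ℂ) {σ l m ε : ℝ} (hσ : 0 < σ) (hε : 0 < ε)
    (hε' : ε ≤ Real.pi / 2) (hz : ∀ t, (z t).re = σ) (hi : ∀ t, l * |t| ≤ |(z t).im| + m) :
    GrowthBound (fun _ t => Gamma (z t)) 0 0 (-(l * (Real.pi / 2 - ε))) := by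
  obtain ⟨C, hC, h⟩ := exists_norm_Gamma_le σ σ hε
  have hG := Real.Gamma_pos_of_pos hσ
  set κ := Real.pi / 2 - ε with hκ
  have hκ0 : 0 ≤ κ := by linarith
  refine GrowthBound.of_bound (C := (C + Real.Gamma σ * Real.exp κ) * Real.exp (κ * m)) fun t => ?_
  have h1 : ‖Gamma (z t)‖ ≤ (C + Real.Gamma σ * Real.exp κ) * Real.exp (-κ * |(z t).im|) := by
    rcases le_total 1 |(z t).im| with hy | hy
    · refine (h (z t) (hz t).ge (hz t).le hy).trans ?_
      gcongr
      linarith [mul_pos hG (Real.exp_pos κ)]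
    · have h2 := norm_Gamma_le_Gamma_re (z := z t) (by rw [hz]; exact hσ)
      rw [hz] at h2
      calc ‖Gamma (z t)‖ ≤ Real.Gamma σ * 1 := by simpa using h2
        _ ≤ Real.Gamma σ * (Real.exp κ * Real.exp (-κ * |(z t).im|)) := by
            gcongr
            rw [← Real.exp_add]
            exact Real.one_le_exp (by nlinarith)
        _ ≤ _ := by
            rw [← mul_assoc]
            gcongr
            linarith
  refine h1.trans ?_
  rw [mul_assoc, ← Real.exp_add]
  gcongr
  nlinarith [mul_le_mul_of_nonneg_left (hi t) hκ0]

/-- The Gamma factors of the Barnes integrand that are regular in the left half plane. -/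
noncomputable def barnesRegular (a : Fin 4 → ℂ) (b z : ℂ) : ℂ :=
  Gamma (a 0 - z) * Gamma (a 1 - z) * Gamma (a 2 - z) * Gamma (a 3 - z) *
    (Gamma (1 / 2 - z))⁻¹ * (Gamma (b - z))⁻¹

/-- The integrand of the Barnes integral. -/
noncomputable def barnesIntegrand (a : Fin 4 → ℂ) (b c z : ℂ) : ℂ :=
  Gamma z * Gamma (c + z) * barnesRegular a b z

/-- The summand of the hypergeometric series, as a function of the complex variable `w`. -/
noncomputable def hypTerm (a : Fin 4 → ℂ) (b c w : ℂ) : ℂ :=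
  Gamma (a 0 + w) * Gamma (a 1 + w) * Gamma (a 2 + w) * Gamma (a 3 + w) *
    (Gamma (1 / 2 + w))⁻¹ * (Gamma (b + w))⁻¹ * (Gamma (1 - c + w))⁻¹ * (Gamma (1 + w))⁻¹

lemma barnesRegular_mul_eq_hypTerm (a : Fin 4 → ℂ) (b c z : ℂ) :
    barnesRegular a b z * (Gamma (1 - c - z))⁻¹ * (Gamma (1 - z))⁻¹ = hypTerm a b c (-z) := by
  simp only [barnesRegular, hypTerm, sub_eq_add_neg]

lemma Gamma_eq_pi_div_sin_mul_inv {z : ℂ} (hz : ∀ m : ℕ, 1 - z ≠ -m) :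
    Gamma z = Real.pi / sin (Real.pi * z) * (Gamma (1 - z))⁻¹ := by
  rw [← Gamma_mul_Gamma_one_sub, mul_inv_cancel_right₀ (Gamma_ne_zero hz)]

lemma tendsto_add_nat_mul_Gamma (n : ℕ) :
    Tendsto (fun z : ℂ => (z + n) * Gamma z) (𝓝[≠] (-n)) (𝓝 ((-1) ^ n / n.factorial)) := by
  induction n with
  | zero => simpa using tendsto_self_mul_Gamma_nhds_zero
  | succ n ih =>
    have h1 : Tendsto (fun z : ℂ => z + 1) (𝓝[≠] (-((n + 1 : ℕ) : ℂ))) (𝓝[≠] (-(n : ℂ))) := by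
      refine tendsto_nhdsWithin_iff.2 ⟨?_, ?_⟩
      · refine tendsto_nhdsWithin_of_tendsto_nhds ?_
        have : ContinuousAt (fun z : ℂ => z + 1) (-((n + 1 : ℕ) : ℂ)) := by fun_prop
        convert this.tendsto using 2
        push_cast; ring
      · filter_upwards [self_mem_nhdsWithin] with z hz h
        apply hz
        simp only [mem_singleton_iff] at h ⊢
        push_cast
        linear_combination h
    have hne : (-((n + 1 : ℕ) : ℂ)) ≠ 0 := neg_ne_zero.2 (Nat.cast_ne_zero.2 n.succ_ne_zero)
    have h2 : Tendsto (fun z : ℂ => z⁻¹) (𝓝[≠] (-((n + 1 : ℕ) : ℂ))) (𝓝 (-((n + 1 : ℕ) : ℂ))⁻¹) :=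
      tendsto_nhdsWithin_of_tendsto_nhds (tendsto_inv₀ hne)
    have h3 := (ih.comp h1).mul h2
    have hv : (-1 : ℂ) ^ (n + 1) / ((n + 1).factorial : ℂ) =
        (-1) ^ n / n.factorial * (-((n + 1 : ℕ) : ℂ))⁻¹ := by
      rw [Nat.factorial_succ, inv_neg, pow_succ]
      push_cast
      field_simp
    rw [hv]
    refine h3.congr' ?_
    have h4 : ∀ᶠ z : ℂ in 𝓝[≠] (-((n + 1 : ℕ) : ℂ)), z ≠ 0 :=
      nhdsWithin_le_nhds (isOpen_ne.mem_nhds hne)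
    filter_upwards [h4] with z hz
    simp only [Function.comp_apply]
    rw [Gamma_add_one z hz]
    push_cast
    field_simp
    ring

lemma differentiableAt_barnesRegular {a : Fin 4 → ℂ} {b z : ℂ} (h : ∀ i, z.re < (a i).re) :
    DifferentiableAt ℂ (barnesRegular a b) z := by
  have hG : ∀ i, DifferentiableAt ℂ (fun z => Gamma (a i - z)) z := fun i => by
    refine DifferentiableAt.comp z (differentiableAt_Gamma _ fun m hm => ?_) (by fun_prop)
    have := congrArg re hm
    simp at this
    have := h i
    have := Nat.cast_nonneg (α := ℝ) m
    linarith
  have hI : ∀ d : ℂ, DifferentiableAt ℂ (fun z => (Gamma (d - z))⁻¹) z := fun d =>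
    DifferentiableAt.comp (g := fun s => (Gamma s)⁻¹) (f := fun z => d - z) z
      (differentiable_one_div_Gamma (d - z)) (by fun_prop)
  unfold barnesRegular
  exact (((((hG 0).mul (hG 1)).mul (hG 2)).mul (hG 3)).mul (hI _)).mul (hI _)

lemma ne_intCast_of_re {c : ℂ} (hc : ∀ k : ℤ, c.re ≠ k) (k : ℤ) : c ≠ k := fun h =>
  hc k (by simpa using congrArg re h)

lemma tendsto_barnesIntegrand_neg_nat {a : Fin 4 → ℂ} {b c : ℂ} (ha : ∀ i, 0 < (a i).re)
    (hc : ∀ k : ℤ, c.re ≠ k) (n : ℕ) :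
    Tendsto (fun z => (z - -(n : ℂ)) * barnesIntegrand a b c z) (𝓝[≠] (-(n : ℂ)))
      (𝓝 (Real.pi / sin (Real.pi * c) * hypTerm a b c n)) := by
  have hcont : ContinuousAt (fun z => Gamma (c + z) * barnesRegular a b z) (-(n : ℂ)) := by
    refine ContinuousAt.mul ?_ (differentiableAt_barnesRegular fun i => ?_).continuousAt
    · refine ContinuousAt.comp (f := fun z => c + z) (continuousAt_Gamma _ fun m hm => ?_)
        (by fun_prop)
      refine ne_intCast_of_re hc (n - m) ?_
      push_cast
      linear_combination hm
    · have := ha i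
      have := Nat.cast_nonneg (α := ℝ) n
      simp; linarith
  have h := (tendsto_add_nat_mul_Gamma n).mul (tendsto_nhdsWithin_of_tendsto_nhds hcont.tendsto)
  have hv : Real.pi / sin (Real.pi * c) * hypTerm a b c n =
      (-1) ^ n / n.factorial * (Gamma (c + -(n : ℂ)) * barnesRegular a b (-n)) := by
    have h1 := barnesRegular_mul_eq_hypTerm a b c (-n)
    rw [neg_neg] at h1
    rw [← h1, Gamma_eq_pi_div_sin_mul_inv (z := c + -(n : ℂ)) fun m hm => ?_,
      show (Real.pi : ℂ) * (c + -n) = Real.pi * c - n * Real.pi by ring,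
      sin_antiperiodic.sub_nat_mul_eq,
      show 1 - -(n : ℂ) = n + 1 by ring, Gamma_nat_eq_factorial,
      show 1 - (c + -(n : ℂ)) = 1 - c - -n by ring]
    · have : ((-1 : ℂ) ^ n) * (-1) ^ n = 1 := by rw [← mul_pow]; simp
      have h0 : ((-1 : ℂ) ^ n) ≠ 0 := by simp
      field_simp
    · refine ne_intCast_of_re hc (1 + n + m) ?_
      push_cast
      linear_combination -hm
  rw [hv]
  refine h.congr fun z => ?_
  rw [barnesIntegrand]
  ring

lemma tendsto_barnesIntegrand_neg_sub_nat {a : Fin 4 → ℂ} {b c : ℂ} (ha : ∀ i, 0 < (a i).re)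
    (hc0 : 0 < c.re) (hc : ∀ k : ℤ, c.re ≠ k) (n : ℕ) :
    Tendsto (fun z => (z - (-c - n)) * barnesIntegrand a b c z) (𝓝[≠] (-c - n))
      (𝓝 (-(Real.pi / sin (Real.pi * c) * hypTerm a b c (c + n)))) := by
  have hcont : ContinuousAt (fun z => Gamma z * barnesRegular a b z) (-c - (n : ℂ)) := by
    refine ContinuousAt.mul (continuousAt_Gamma _ fun m hm => ?_)
      (differentiableAt_barnesRegular fun i => ?_).continuousAt
    · refine ne_intCast_of_re hc (m - n) ?_
      push_cast
      linear_combination -hm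
    · have := ha i
      have := Nat.cast_nonneg (α := ℝ) n
      simp; linarith
  have h1 : Tendsto (fun z : ℂ => c + z) (𝓝[≠] (-c - n)) (𝓝[≠] (-(n : ℂ))) := by
    refine tendsto_nhdsWithin_iff.2 ⟨?_, ?_⟩
    · refine tendsto_nhdsWithin_of_tendsto_nhds ?_
      have : ContinuousAt (fun z : ℂ => c + z) (-c - n) := by fun_prop
      convert this.tendsto using 2
      ring
    · filter_upwards [self_mem_nhdsWithin] with z hz h
      apply hz
      simp only [mem_singleton_iff] at h ⊢
      linear_combination h
  have h := ((tendsto_add_nat_mul_Gamma n).comp h1).mul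
    (tendsto_nhdsWithin_of_tendsto_nhds hcont.tendsto)
  have hv : -(Real.pi / sin (Real.pi * c) * hypTerm a b c (c + n)) =
      (-1) ^ n / n.factorial * (Gamma (-c - n) * barnesRegular a b (-c - n)) := by
    have h1 := barnesRegular_mul_eq_hypTerm a b c (-c - n)
    rw [show -(-c - (n : ℂ)) = c + n by ring] at h1
    rw [← h1, Gamma_eq_pi_div_sin_mul_inv (z := -c - (n : ℂ)) fun m hm => ?_,
      show (Real.pi : ℂ) * (-c - n) = -(Real.pi * c + n * Real.pi) by ring, sin_neg,
      sin_antiperiodic.add_nat_mul_eq,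
      show 1 - c - (-c - (n : ℂ)) = n + 1 by ring, Gamma_nat_eq_factorial]
    · have : ((-1 : ℂ) ^ n) * (-1) ^ n = 1 := by rw [← mul_pow]; simp
      have h0 : ((-1 : ℂ) ^ n) ≠ 0 := by simp
      field_simp
    · have := congrArg re hm
      simp at this
      have := Nat.cast_nonneg (α := ℝ) n
      have := Nat.cast_nonneg (α := ℝ) m
      linarith
  rw [hv]
  refine h.congr fun z => ?_
  simp only [barnesIntegrand, Function.comp_apply]
  ring

/-- `‖f (x + i y)‖ ≪ exp(κ|y|)` for large `|y|`, uniformly for `x ∈ [A, B]`. -/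
def StripBound (A B : ℝ) (f : ℂ → ℂ) (κ : ℝ) : Prop :=
  ∃ C Y : ℝ, 0 ≤ C ∧ ∀ x y : ℝ, A ≤ x → x ≤ B → Y ≤ |y| → ‖f (x + y * I)‖ ≤ C * Real.exp (κ * |y|)

namespace StripBound

variable {A B : ℝ}

lemma mul {f g : ℂ → ℂ} {κ l : ℝ} (hf : StripBound A B f κ) (hg : StripBound A B g l) :
    StripBound A B (fun z => f z * g z) (κ + l) := by
  obtain ⟨C, Y, hC, hf⟩ := hf
  obtain ⟨D, Z, hD, hg⟩ := hg
  refine ⟨C * D, max Y Z, by positivity, fun x y hA hB hy => ?_⟩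
  rw [norm_mul, add_mul, Real.exp_add]
  calc _ ≤ _ := mul_le_mul (hf x y hA hB ((le_max_left _ _).trans hy))
        (hg x y hA hB ((le_max_right _ _).trans hy)) (norm_nonneg _) (by positivity)
    _ = _ := by ring

lemma abs_re_le {e x : ℝ} (he : |e| = 1) (hA : A ≤ x) (hB : x ≤ B) : |e * x| ≤ |A| + |B| := by
  rw [abs_mul, he, one_mul]
  exact abs_le.2 ⟨by linarith [neg_abs_le A, abs_nonneg B], by linarith [le_abs_self B, abs_nonneg A]⟩

lemma gamma (d : ℂ) {e ε : ℝ} (he : |e| = 1) (hε : 0 < ε) (hε' : ε ≤ Real.pi / 2) :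
    StripBound A B (fun z => Gamma (d + e * z)) (-(Real.pi / 2 - ε)) := by
  obtain ⟨C, hC, h⟩ := exists_norm_Gamma_le (d.re - (|A| + |B|)) (d.re + (|A| + |B|)) hε
  refine ⟨C * Real.exp ((Real.pi / 2 - ε) * |d.im|), 1 + |d.im|, by positivity,
    fun x y hA hB hy => ?_⟩
  have hx := abs_le.1 (abs_re_le he hA hB)
  have hre : (d + e * (x + y * I)).re = d.re + e * x := by simp
  have him : (d + e * (x + y * I)).im = d.im + e * y := by simp
  have hy' : |y| ≤ |d.im + e * y| + |d.im| := by
    have := abs_sub (d.im + e * y) d.im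
    rwa [add_sub_cancel_left, abs_mul, he, one_mul] at this
  have := h (d + e * (x + y * I)) (by rw [hre]; linarith) (by rw [hre]; linarith)
    (by rw [him]; linarith)
  rw [him] at this
  refine this.trans ?_
  rw [mul_assoc, ← Real.exp_add]
  gcongr
  nlinarith

lemma inv_gamma (d : ℂ) {e ε : ℝ} (he : |e| = 1) (hε : 0 < ε) :
    StripBound A B (fun z => (Gamma (d + e * z))⁻¹) (Real.pi / 2 + ε) := by
  obtain ⟨C, hC, h⟩ := exists_norm_inv_Gamma_le (d.re - (|A| + |B|)) (d.re + (|A| + |B|)) hε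
  refine ⟨C * Real.exp ((Real.pi / 2 + ε) * |d.im|), 0, by positivity,
    fun x y hA hB hy => ?_⟩
  have hx := abs_le.1 (abs_re_le he hA hB)
  have hre : (d + e * (x + y * I)).re = d.re + e * x := by simp
  have him : (d + e * (x + y * I)).im = d.im + e * y := by simp
  have hy' : |d.im + e * y| ≤ |d.im| + |y| := by
    have := abs_add_le d.im (e * y)
    rwa [abs_mul, he, one_mul] at this
  have := h (d + e * (x + y * I)) (by rw [hre]; linarith) (by rw [hre]; linarith)
  rw [him] at this
  refine this.trans ?_
  rw [mul_assoc, ← Real.exp_add]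
  gcongr
  nlinarith [Real.pi_pos]

end StripBound

lemma stripBound_barnesIntegrand (A B : ℝ) (a : Fin 4 → ℂ) (b c : ℂ) :
    StripBound A B (barnesIntegrand a b c) (-1) := by
  have hp := Real.pi_gt_three
  have hG := fun d : ℂ => StripBound.gamma (A := A) (B := B) d (e := -1) (ε := 1 / 8) (by simp)
    (by norm_num) (by linarith)
  have hG' := fun d : ℂ => StripBound.gamma (A := A) (B := B) d (e := 1) (ε := 1 / 8) (by simp)
    (by norm_num) (by linarith)
  have hI := fun d : ℂ => StripBound.inv_gamma (A := A) (B := B) d (e := -1) (ε := 1 / 8) (by simp)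
    (by norm_num)
  obtain ⟨C, Y, hC, h⟩ := ((hG' 0).mul (hG' c)).mul
    ((((((hG (a 0)).mul (hG (a 1))).mul (hG (a 2))).mul (hG (a 3))).mul (hI (1 / 2))).mul (hI b))
  refine ⟨C, Y, hC, fun x y hx hx' hy => ?_⟩
  have := h x y hx hx' hy
  simp only [ofReal_one, one_mul, ofReal_neg, neg_mul, zero_add, ← sub_eq_add_neg] at this
  rw [barnesIntegrand, barnesRegular]
  refine this.trans ?_
  gcongr
  linarith

namespace GrowthBound

variable {f : ℕ → ℝ → ℂ} {κ : ℝ}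

lemma summable_nat_add_one_rpow_neg_two : Summable fun N : ℕ => ((N : ℝ) + 1) ^ (-2 : ℝ) := by
  have := (summable_nat_add_iff 1).2 (Real.summable_nat_rpow (p := -2).2 (by norm_num))
  simpa using this

lemma summable (h : GrowthBound f 0 (-2) κ) (t : ℝ) : Summable fun N => f N t := by
  obtain ⟨C, hC, h⟩ := h
  refine Summable.of_norm_bounded
    ((summable_nat_add_one_rpow_neg_two.mul_left C).mul_right (Real.exp (κ * |t|))) fun N => ?_
  simpa [mul_assoc] using h N t

lemma exists_norm_tsum_le (h : GrowthBound f 0 (-2) κ) :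
    ∃ C : ℝ, 0 ≤ C ∧ ∀ t, ‖∑' N, f N t‖ ≤ C * Real.exp (κ * |t|) := by
  obtain ⟨C, hC, h⟩ := h
  refine ⟨∑' N : ℕ, C * ((N : ℝ) + 1) ^ (-2 : ℝ), tsum_nonneg fun N => by positivity, fun t => ?_⟩
  have hs := ((summable_nat_add_one_rpow_neg_two.mul_left C).hasSum.mul_right (Real.exp (κ * |t|)))
  refine tsum_of_norm_bounded hs fun N => ?_
  simpa [mul_assoc] using h N t

lemma tendsto_integral (h : GrowthBound f 0 (-2) κ) (hκ : κ < 0) :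
    Tendsto (fun N => ∫ t : ℝ, f N t) atTop (𝓝 0) := by
  obtain ⟨C, hC, h⟩ := h
  have hi := integrable_exp_neg_mul_abs (neg_pos.2 hκ)
  simp only [neg_neg] at hi
  have h0 : Tendsto (fun N : ℕ => (∫ t : ℝ, C * Real.exp (κ * |t|)) * ((N : ℝ) + 1) ^ (-2 : ℝ)) atTop
      (𝓝 0) := by
    simpa using summable_nat_add_one_rpow_neg_two.tendsto_atTop_zero.const_mul
      (∫ t : ℝ, C * Real.exp (κ * |t|))
  refine squeeze_zero_norm (fun N => ?_) h0
  rw [← integral_mul_const]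
  refine norm_integral_le_of_norm_le ((hi.const_mul C).mul_const _) (ae_of_all _ fun t => ?_)
  refine (h N t).trans (le_of_eq ?_)
  simp; ring

end GrowthBound

lemma growthBound_inv_sin (z : ℝ → ℂ) {σ l m : ℝ} (hσ : ∀ k : ℤ, σ ≠ k) (hz : ∀ t, (z t).re = σ)
    (hi : ∀ t, l * |t| ≤ |(z t).im| + m) :
    GrowthBound (fun _ t => (sin (Real.pi * z t))⁻¹) 0 0 (-(l * Real.pi)) := by
  have hs : 0 < |Real.sin (Real.pi * σ)| := by
    refine abs_pos.2 fun h => ?_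
    obtain ⟨k, hk⟩ := Real.sin_eq_zero_iff.1 h
    refine hσ k ?_
    apply mul_left_cancel₀ Real.pi_ne_zero
    rw [← hk, mul_comm]
  refine GrowthBound.of_bound (C := 2 / |Real.sin (Real.pi * σ)| * Real.exp (Real.pi * m)) fun t => ?_
  have h1 := abs_sin_mul_cosh_le (Real.pi * σ) (Real.pi * (z t).im)
  have h2 := exp_abs_le_two_mul_cosh (Real.pi * (z t).im)
  have hzt : (Real.pi : ℂ) * z t = (Real.pi * σ : ℝ) + (Real.pi * (z t).im : ℝ) * I := by
    conv_lhs => rw [← re_add_im (z t), hz]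
    push_cast; ring
  rw [hzt, norm_inv]
  have hpos : 0 < |Real.sin (Real.pi * σ)| * Real.cosh (Real.pi * (z t).im) :=
    mul_pos hs (Real.cosh_pos _)
  have h3 : Real.exp (Real.pi * (l * |t| - m)) ≤ 2 * Real.cosh (Real.pi * (z t).im) := by
    refine (Real.exp_le_exp.2 ?_).trans h2
    rw [abs_mul, abs_of_pos Real.pi_pos]
    have := hi t
    gcongr
    linarith
  refine (inv_anti₀ hpos h1).trans ?_
  rw [inv_le_iff_one_le_mul₀ hpos]
  have h4 : Real.exp (Real.pi * m) * Real.exp (-(l * Real.pi) * |t|) *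
      Real.exp (Real.pi * (l * |t| - m)) = 1 := by
    rw [← Real.exp_add, ← Real.exp_add, Real.exp_eq_one_iff]
    ring
  calc (1:ℝ) = Real.exp (Real.pi * m) * Real.exp (-(l * Real.pi) * |t|) *
      Real.exp (Real.pi * (l * |t| - m)) := h4.symm
    _ ≤ Real.exp (Real.pi * m) * Real.exp (-(l * Real.pi) * |t|) *
      (2 * Real.cosh (Real.pi * (z t).im)) := by gcongr
    _ = _ := by field_simp

lemma growthBound_hypTerm (a : Fin 4 → ℂ) (b c w : ℝ → ℂ) {β γ σ l₁ l₂ l₃ m₁ m₂ m₃ ε : ℝ}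
    (hε : 0 < ε) (hl₁ : 0 ≤ l₁) (hl₂ : 0 ≤ l₂) (hl₃ : 0 ≤ l₃)
    (hb : ∀ t, (b t).re = β) (hc : ∀ t, (c t).re = γ) (hw : ∀ t, (w t).re = σ)
    (ha : ∀ i, 0 < (a i).re + σ) (hβ : (a 0).re < β)
    (hbal : β - γ + 1 / 2 = (a 0).re + (a 1).re + (a 2).re + (a 3).re)
    (him₁ : ∀ t, |(b t - a 0).im| ≤ l₁ * |t| + m₁) (him₂ : ∀ t, |(w t).im| ≤ l₂ * |t| + m₂)
    (him₃ : ∀ t, |(w t - c t).im| ≤ l₃ * |t| + m₃) :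
    GrowthBound (fun N t => hypTerm a (b t) (c t) (w t + N)) 0 (-2)
      ((l₁ + 2 * l₂ + l₃) * (Real.pi / 2 + ε)) := by
  have hG := fun i => growthBound_Gamma (fun t => a i + w t) (ha i) (fun t => by simp [hw])
  have hB := growthBound_Gamma_mul_inv_Gamma_add (fun t => a 0 + w t) (fun t => b t - a 0) hε hl₁
    (ha 0) (sub_pos.2 hβ) (fun t => by simp [hw]) (fun t => by simp [hb]) him₁
  have h₁ := growthBound_inv_Gamma (fun t => 1 / 2 + w t) (σ := 1 / 2 + σ) hε hl₂
    (fun t => by simp [hw]) (fun t => by simpa using him₂ t)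
  have h₂ := growthBound_inv_Gamma (fun t => 1 + w t) (σ := 1 + σ) hε hl₂
    (fun t => by simp [hw]) (fun t => by simpa using him₂ t)
  have h₃ := growthBound_inv_Gamma (fun t => 1 - c t + w t) (σ := 1 - γ + σ) hε hl₃
    (fun t => by simp [hw, hc]) (fun t => by
      have := him₃ t
      simp only [add_im, sub_im, one_im, zero_sub] at this ⊢
      rwa [neg_add_eq_sub])
  refine ((((((hG 1).mul (hG 2)).mul (hG 3)).mul hB).mul h₁).mul (h₂.mul h₃)).congr
    (fun N t => ?_) (by norm_num) (by linarith) (by linarith)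
  simp only [hypTerm]
  rw [show a 0 + w t + (b t - a 0) + (N : ℂ) = b t + (w t + N) by ring]
  simp only [add_assoc]
  ring

lemma barnesIntegrand_sub_nat {a : Fin 4 → ℂ} {b c z : ℂ} (hz : z.re < 1)
    (hcz : ∀ k : ℤ, (c + z).re ≠ k) (N : ℕ) :
    barnesIntegrand a b c (z - N) =
      Real.pi ^ 2 * (sin (Real.pi * z))⁻¹ * (sin (Real.pi * (c + z)))⁻¹ *
        hypTerm a b c (-z + N) := by
  have hN := Nat.cast_nonneg (α := ℝ) N
  have h1 := Gamma_eq_pi_div_sin_mul_inv (z := z - N) fun m hm => by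
    have := congrArg re hm
    simp at this
    have := Nat.cast_nonneg (α := ℝ) m
    linarith
  have h2 := Gamma_eq_pi_div_sin_mul_inv (z := c + z - N) fun m hm => by
    refine ne_intCast_of_re hcz (1 + N + m) ?_
    push_cast
    linear_combination -hm
  rw [show (Real.pi : ℂ) * (z - N) = Real.pi * z - N * Real.pi by ring,
    sin_antiperiodic.sub_nat_mul_eq] at h1
  rw [show (Real.pi : ℂ) * (c + z - N) = Real.pi * (c + z) - N * Real.pi by ring,
    sin_antiperiodic.sub_nat_mul_eq] at h2
  have h3 := barnesRegular_mul_eq_hypTerm a b c (z - N)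
  rw [show -(z - (N : ℂ)) = -z + N by ring] at h3
  rw [← h3, barnesIntegrand, ← add_sub_assoc, h1, h2,
    show 1 - (c + z - (N : ℂ)) = 1 - c - (z - N) by ring]
  have : ((-1 : ℂ) ^ N)⁻¹ * ((-1) ^ N)⁻¹ = 1 := by
    rw [← mul_inv, ← mul_pow]; simp
  simp only [div_eq_mul_inv, mul_inv]
  linear_combination (Real.pi ^ 2 * (sin (Real.pi * z))⁻¹ * (sin (Real.pi * (c + z)))⁻¹ *
    (barnesRegular a b (z - N) * (Gamma (1 - c - (z - N)))⁻¹ * (Gamma (1 - (z - N)))⁻¹)) * this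

/-- The standing assumptions on the parameters of the Barnes integral. -/
structure BarnesParams (a : Fin 4 → ℂ) (b c : ℂ) (x₀ : ℝ) : Prop where
  pos : 0 < x₀
  lt_re : ∀ i, x₀ < (a i).re
  re_c_pos : 0 < c.re
  re_c_ne : ∀ k : ℤ, c.re ≠ k
  re_lt : (a 0).re < b.re
  balance : b - c + 1 / 2 = a 0 + a 1 + a 2 + a 3

namespace BarnesParams

variable {a : Fin 4 → ℂ} {b c : ℂ} {x₀ : ℝ}

lemma re_pos (h : BarnesParams a b c x₀) (i : Fin 4) : 0 < (a i).re := h.pos.trans (h.lt_re i)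

lemma re_balance (h : BarnesParams a b c x₀) :
    b.re - c.re + 1 / 2 = (a 0).re + (a 1).re + (a 2).re + (a 3).re := by
  simpa using congrArg re h.balance

lemma summable (h : BarnesParams a b c x₀) {w : ℂ} (hw : 0 ≤ w.re) :
    Summable fun n : ℕ => hypTerm a b c (w + n) :=
  (growthBound_hypTerm a (fun _ => b) (fun _ => c) (fun _ => w) (ε := 1) (l₁ := 0) (l₂ := 0)
    (l₃ := 0) one_pos le_rfl le_rfl le_rfl (fun _ => rfl) (fun _ => rfl) (fun _ => rfl)
    (fun i => add_pos_of_pos_of_nonneg (h.re_pos i) hw) h.re_lt h.re_balance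
    (fun _ => by simpa using le_rfl) (fun _ => by simpa using le_rfl)
    (fun _ => by simpa using le_rfl)).summable 0

lemma growthBound_line (h : BarnesParams a b c x₀) {x₁ : ℝ} (hx : x₁ ≤ 0) (hx₁ : ∀ k : ℤ, x₁ ≠ k)
    (hcx : ∀ k : ℤ, c.re + x₁ ≠ k) :
    GrowthBound (fun N y => barnesIntegrand a b c (x₁ - N + y * I)) 0 (-2) (-1) := by
  have h1 := growthBound_inv_sin (fun y : ℝ => (x₁ + y * I : ℂ)) (l := 1) (m := 0) hx₁
    (fun t => by simp) (fun t => by simp)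
  have h2 := growthBound_inv_sin (fun y : ℝ => (c + (x₁ + y * I) : ℂ)) (l := 1) (m := |c.im|) hcx
    (fun t => by simp) (fun t => by
      have := abs_sub (c.im + t) c.im
      simpa using this)
  have h3 := growthBound_hypTerm a (fun _ => b) (fun _ => c) (fun y : ℝ => -(x₁ + y * I : ℂ))
    (ε := 1 / 8) (l₁ := 0) (l₂ := 1) (l₃ := 1) (m₁ := |(b - a 0).im|) (m₂ := 0) (m₃ := |c.im|)
    (β := b.re) (γ := c.re) (σ := -x₁)
    (by norm_num) le_rfl zero_le_one zero_le_one (fun _ => rfl) (fun _ => rfl) (fun _ => by simp)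
    (fun i => add_pos_of_pos_of_nonneg (h.re_pos i) (by linarith)) h.re_lt h.re_balance
    (fun _ => by simp) (fun _ => by simp)
    (fun t => by
      have := abs_sub (-t) c.im
      simpa using this)
  refine ((((GrowthBound.const (Real.pi ^ 2)).mul h1).mul h2).mul h3).congr (fun N t => ?_)
    (by norm_num) (by norm_num) (by linarith [Real.pi_gt_three])
  rw [show (x₁ - N + t * I : ℂ) = (x₁ + t * I) - N by ring,
    barnesIntegrand_sub_nat (by simp; linarith) (by simpa using hcx)]

end BarnesParams

/-- The Barnes integral as a difference of two hypergeometric series. -/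
theorem BarnesParams.integral_eq {a : Fin 4 → ℂ} {b c : ℂ} {x₀ : ℝ} (h : BarnesParams a b c x₀) :
    ∫ y : ℝ, barnesIntegrand a b c (x₀ + y * I) = 2 * Real.pi * (Real.pi / sin (Real.pi * c)) *
      (∑' n : ℕ, hypTerm a b c n - ∑' n : ℕ, hypTerm a b c (c + n)) := by
  set m := ⌊c.re⌋₊ with hm
  have hm1 : (m : ℝ) < c.re := lt_of_le_of_ne (Nat.floor_le h.re_c_pos.le)
    fun h' => h.re_c_ne m (by exact_mod_cast h'.symm)
  have hm2 : c.re < m + 1 := Nat.lt_floor_add_one _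
  set x₁ : ℝ := -((c.re + m) / 2) with hx₁
  have hm0 := Nat.cast_nonneg (α := ℝ) m
  have hline := (h.growthBound_line (x₁ := x₁) (by linarith)
    (fun k hk => by
      have e1 : (-(m + 1) : ℤ) < k := by
        have : (-(m + 1) : ℝ) < k := by rw [← hk]; linarith
        exact_mod_cast this
      have e2 : k < (-m : ℤ) := by
        have : (k : ℝ) < -m := by rw [← hk]; linarith
        exact_mod_cast this
      omega)
    (fun k hk => by
      have e1 : (0 : ℤ) < k := by
        have : (0 : ℝ) < k := by rw [← hk]; linarith
        exact_mod_cast this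
      have e2 : k < (1 : ℤ) := by
        have : (k : ℝ) < 1 := by rw [← hk]; linarith
        exact_mod_cast this
      omega)).tendsto_integral (by norm_num)
  set K : ℂ := Real.pi / sin (Real.pi * c) with hK
  have key : ∀ M : ℕ, (∫ y : ℝ, barnesIntegrand a b c (x₀ + y * I)) -
      (∫ y : ℝ, barnesIntegrand a b c (x₁ - M + y * I)) =
      2 * Real.pi * (∑ n ∈ Finset.range (M + (m + 1)), K * hypTerm a b c n +
        ∑ n ∈ Finset.range M, -(K * hypTerm a b c (c + n))) := by
    intro M
    have hM0 := Nat.cast_nonneg (α := ℝ) M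
    have hinj₁ : Function.Injective fun n : ℕ => -(n : ℂ) := fun i j hij => by simpa using hij
    have hinj₂ : Function.Injective fun n : ℕ => -c - (n : ℂ) := fun i j hij => by simpa using hij
    set S₁ := (Finset.range (M + (m + 1))).image fun n : ℕ => -(n : ℂ) with hS₁
    set S₂ := (Finset.range M).image fun n : ℕ => -c - (n : ℂ) with hS₂
    have hdisj : Disjoint S₁ S₂ := by
      rw [Finset.disjoint_left]
      intro p hp hp'
      obtain ⟨i, -, rfl⟩ := Finset.mem_image.1 hp
      obtain ⟨j, -, hj⟩ := Finset.mem_image.1 hp'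
      refine ne_intCast_of_re h.re_c_ne (i - j) ?_
      push_cast
      linear_combination -hj
    let r : ℂ → ℂ := fun p => if p ∈ S₁ then K * hypTerm a b c (-p) else -(K * hypTerm a b c (-p))
    obtain ⟨C, Y, hC, hb⟩ := stripBound_barnesIntegrand (x₁ - M) x₀ a b c
    have hres := integral_vertical_sub_eq_sum_residues (S₁ ∪ S₂) (barnesIntegrand a b c) r
      (x₁ - M) x₀ ?_ (by linarith [h.pos]) ?_ ?_ one_pos hb
    · rw [Finset.sum_union hdisj] at hres
      have e₁ : ∑ p ∈ S₁, r p = ∑ n ∈ Finset.range (M + (m + 1)), K * hypTerm a b c n := by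
        rw [hS₁, Finset.sum_image fun i _ j _ hij => hinj₁ hij]
        refine Finset.sum_congr rfl fun n hn => ?_
        have : -(n : ℂ) ∈ S₁ := Finset.mem_image_of_mem _ hn
        simp only [r, if_pos this, neg_neg]
      have e₂ : ∑ p ∈ S₂, r p = ∑ n ∈ Finset.range M, -(K * hypTerm a b c (c + n)) := by
        rw [hS₂, Finset.sum_image fun i _ j _ hij => hinj₂ hij]
        refine Finset.sum_congr rfl fun n hn => ?_
        have : -c - (n : ℂ) ∉ S₁ := Finset.disjoint_right.1 hdisj (Finset.mem_image_of_mem _ hn)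
        simp only [r, if_neg this, neg_sub, sub_neg_eq_add]
        rw [add_comm (n : ℂ)]
      rw [e₁, e₂] at hres
      rw [← hres]
      push_cast
      rfl
    · intro p hp
      rcases Finset.mem_union.1 hp with hp | hp
      · obtain ⟨n, hn, rfl⟩ := Finset.mem_image.1 hp
        have hn' : (n : ℝ) ≤ M + m := by
          have : n ≤ M + m := by have := Finset.mem_range.1 hn; omega
          exact_mod_cast this
        have := Nat.cast_nonneg (α := ℝ) n
        have := h.pos
        simp only [neg_re, natCast_re]
        constructor <;> linarith
      · obtain ⟨n, hn, rfl⟩ := Finset.mem_image.1 hp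
        have hn' : (n : ℝ) + 1 ≤ M := by
          have := Finset.mem_range.1 hn
          exact_mod_cast this
        have := Nat.cast_nonneg (α := ℝ) n
        have := h.pos
        have := h.re_c_pos
        simp only [neg_re, natCast_re, sub_re]
        constructor <;> linarith
    · intro z hz hz' hzS
      have d1 : DifferentiableAt ℂ Gamma z := by
        refine differentiableAt_Gamma _ fun n hn => hzS (Finset.mem_union_left _ ?_)
        refine Finset.mem_image.2 ⟨n, Finset.mem_range.2 ?_, hn.symm⟩
        rw [hn] at hz
        simp only [neg_re, natCast_re] at hz
        have : (n : ℝ) < (M + (m + 1) : ℕ) := by push_cast; linarith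
        exact_mod_cast this
      have d2 : DifferentiableAt ℂ (fun z => Gamma (c + z)) z := by
        refine DifferentiableAt.comp (f := fun z => c + z) z
          (differentiableAt_Gamma _ fun n hn => hzS (Finset.mem_union_right _ ?_)) (by fun_prop)
        have hzn : z = -c - n := by linear_combination hn
        refine Finset.mem_image.2 ⟨n, Finset.mem_range.2 ?_, hzn.symm⟩
        rw [hzn] at hz
        simp only [sub_re, neg_re, natCast_re] at hz
        have : (n : ℝ) < M := by linarith
        exact_mod_cast this
      exact (d1.mul d2).mul (differentiableAt_barnesRegular fun i => hz'.trans_lt (h.lt_re i))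
    · intro p hp
      rcases Finset.mem_union.1 hp with hp | hp
      · simp only [r, if_pos hp]
        obtain ⟨n, hn, rfl⟩ := Finset.mem_image.1 hp
        simpa only [neg_neg] using tendsto_barnesIntegrand_neg_nat h.re_pos h.re_c_ne n
      · simp only [r, if_neg (Finset.disjoint_right.1 hdisj hp)]
        obtain ⟨n, hn, rfl⟩ := Finset.mem_image.1 hp
        have := tendsto_barnesIntegrand_neg_sub_nat (a := a) (b := b) h.re_pos h.re_c_pos
          h.re_c_ne n
        rwa [show -(-c - (n : ℂ)) = c + n by ring]
  have s1 : Summable fun n : ℕ => K * hypTerm a b c n := by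
    have := h.summable (w := 0) le_rfl
    simp only [zero_add] at this
    exact this.mul_left K
  have s2 : Summable fun n : ℕ => -(K * hypTerm a b c (c + n)) :=
    ((h.summable h.re_c_pos.le).mul_left K).neg
  have t1 := s1.hasSum.tendsto_sum_nat.comp (tendsto_add_atTop_nat (m + 1))
  have t2 := (t1.add s2.hasSum.tendsto_sum_nat).const_mul (2 * (Real.pi : ℂ))
  have t3 := (tendsto_const_nhds (x := ∫ y : ℝ, barnesIntegrand a b c (x₀ + y * I))).sub hline
  rw [sub_zero] at t3
  have := tendsto_nhds_unique t3 (t2.congr fun M => (key M).symm)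
  rw [this, tsum_neg, tsum_mul_left, tsum_mul_left]
  ring

@[fun_prop]
lemma measurable_Gamma : Measurable Gamma := by
  have := differentiable_one_div_Gamma.continuous.measurable.inv
  rwa [show (fun s => (Gamma s)⁻¹)⁻¹ = Gamma from funext fun s => inv_inv _] at this

lemma measurable_tsum_of_summable {f : ℕ → ℝ → ℂ} (hf : ∀ n, Measurable (f n))
    (hs : ∀ t, Summable fun n => f n t) : Measurable fun t => ∑' n, f n t := by
  refine measurable_of_tendsto_metrizable (f := fun N t => ∑ n ∈ Finset.range N, f n t)
    (fun N => Finset.measurable_fun_sum _ fun n _ => hf n) ?_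
  exact tendsto_pi_nhds.2 fun t => (hs t).hasSum.tendsto_sum_nat

lemma GrowthBound.at_zero {f : ℕ → ℝ → ℂ} {j : ℤ} {p κ : ℝ} (h : GrowthBound f j p κ) :
    GrowthBound (fun _ t => f 0 t) 0 0 κ := by
  obtain ⟨C, -, h⟩ := h
  exact GrowthBound.of_bound (C := C) fun t => by simpa using h 0 t

lemma integrable_of_growthBound {u : ℝ → ℂ} {κ : ℝ} (hu : Measurable u)
    (h : GrowthBound (fun _ t => u t) 0 0 κ) (hκ : κ < 0) : Integrable u := by
  obtain ⟨C, hC, h⟩ := h.bound_of_const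
  have hi := integrable_exp_neg_mul_abs (neg_pos.2 hκ)
  simp only [neg_neg] at hi
  exact (hi.const_mul C).mono' hu.aestronglyMeasurable (ae_of_all _ h)

lemma norm_mellin_integrand (h : ℝ → ℂ) {w : ℂ} {σ : ℝ} (hw : w.re = σ) {y : ℝ} (hy : 0 < y) :
    ‖h y * (y : ℂ) ^ (w - 1)‖ = ‖h y‖ * y ^ (σ - 1) := by
  rw [norm_mul, norm_cpow_eq_rpow_re_of_pos hy, sub_re, hw, one_re]

lemma norm_mellinT_le (h : ℝ → ℂ) {w : ℂ} {σ : ℝ} (hw : w.re = σ) :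
    ‖mellinT h w‖ ≤ ∫ y in Ioi (0 : ℝ), ‖h y‖ * y ^ (σ - 1) := by
  refine (norm_integral_le_integral_norm _).trans (le_of_eq ?_)
  exact setIntegral_congr_fun measurableSet_Ioi fun y hy => norm_mellin_integrand h hw hy

lemma continuous_mellinT_of_re_eq (h : ℝ → ℂ) {w : ℝ → ℂ} {σ : ℝ} (hwc : Continuous w)
    (hw : ∀ t, (w t).re = σ) : Continuous fun t => mellinT h (w t) := by
  by_cases hex : ∃ t₀, IntegrableOn (fun y : ℝ => h y * (y : ℂ) ^ (w t₀ - 1)) (Ioi 0)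
  · obtain ⟨t₀, h₀⟩ := hex
    refine continuous_of_dominated (bound := fun y => ‖h y * (y : ℂ) ^ (w t₀ - 1)‖) (fun t => ?_)
      (fun t => ?_) h₀.norm ?_
    · have hm : AEStronglyMeasurable (fun y : ℝ => (y : ℂ) ^ (w t - w t₀))
          (volume.restrict (Ioi 0)) := by
        have : Measurable fun y : ℝ => (y : ℂ) ^ (w t - w t₀) := by fun_prop
        exact this.aestronglyMeasurable
      refine (h₀.1.mul hm).congr ?_
      filter_upwards [ae_restrict_mem measurableSet_Ioi] with y hy
      have hy0 : (y : ℂ) ≠ 0 := ofReal_ne_zero.2 (ne_of_gt hy)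
      simp only [Pi.mul_apply]
      rw [mul_assoc, ← cpow_add _ _ hy0]
      congr 2
      ring
    · filter_upwards [ae_restrict_mem measurableSet_Ioi] with y hy
      rw [norm_mellin_integrand h (hw t) hy, norm_mellin_integrand h (hw t₀) hy]
    · filter_upwards [ae_restrict_mem measurableSet_Ioi] with y hy
      have hy0 : (y : ℂ) ≠ 0 := ofReal_ne_zero.2 (ne_of_gt hy)
      refine continuous_const.mul (Continuous.const_cpow (by fun_prop) (Or.inl hy0))
  · push Not at hex
    have : (fun t => mellinT h (w t)) = fun _ => 0 :=
      funext fun t => integral_undef (hex t)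
    rw [this]
    exact continuous_const

lemma hyp4F3hat_eq_tsum_hypTerm (a : Fin 4 → ℂ) (b c : ℂ) :
    hyp4F3hat (a 3) (a 0) (a 1) (a 2) (1 / 2) b (1 - c) = ∑' n : ℕ, hypTerm a b c n := by
  refine tsum_congr fun n => ?_
  rw [hypTerm, add_comm (1 : ℂ) n, Gamma_nat_eq_factorial]
  simp only [div_eq_mul_inv, mul_inv]
  ring

lemma hyp4F3hat_eq_tsum_hypTerm_add (a : Fin 4 → ℂ) (b c : ℂ) :
    hyp4F3hat (a 3 + c) (a 0 + c) (a 1 + c) (a 2 + c) (b + c) (1 / 2 + c) (1 + c) =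
      ∑' n : ℕ, hypTerm a b c (c + n) := by
  refine tsum_congr fun n => ?_
  rw [hypTerm, show 1 - c + (c + (n : ℂ)) = n + 1 by ring, Gamma_nat_eq_factorial]
  simp only [div_eq_mul_inv, mul_inv, add_assoc]
  ring

section Transform

variable (η : ℝ) (α : Fin 3 → ℂ) (H : ℂ → ℂ) (s0 s : ℂ)

/-- The point `s₁ = (η - 1/2) + i t` of the outer line of integration. -/
noncomputable def outerPoint (t : ℝ) : ℂ := ((η : ℝ) - 1/2 : ℝ) + t * I

/-- The upper parameters of the hypergeometric series. -/
noncomputable def upperParams : Fin 4 → ℂ :=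
  ![(s0 + α 0) / 2, (s0 + α 1) / 2, (s0 + α 2) / 2, s - s0 / 2]

/-- The parameter `b` of the inner Barnes integral. -/
noncomputable def lowerParam (t : ℝ) : ℂ := (s0 + outerPoint η t) / 2

/-- The shift parameter `c` of the inner Barnes integral. -/
noncomputable def shiftParam (t : ℝ) : ℂ := (outerPoint η t - s0) / 2 + 1 / 2 - s

/-- The factor of the integrand that depends only on the outer variable. -/
noncomputable def outerFactor (t : ℝ) : ℂ :=
  mellinT (Hflat H) (s - outerPoint η t - 1/2) *
    ((∏ i, Gamma ((outerPoint η t - α i) / 2)) / Gamma ((1 + outerPoint η t) / 2 - s0)) *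
    (Real.pi : ℂ) ^ (-outerPoint η t)

variable {η α s0 s}

@[simp] lemma outerPoint_re (t : ℝ) : (outerPoint η t).re = η - 1 / 2 := by
  simp only [outerPoint, add_re, ofReal_re, mul_re, I_re, ofReal_im, I_im]
  ring

@[simp] lemma outerPoint_im (t : ℝ) : (outerPoint η t).im = t := by
  simp [outerPoint]

lemma continuous_outerPoint : Continuous (outerPoint η) := by
  unfold outerPoint
  fun_prop

lemma lowerParam_re (t : ℝ) : (lowerParam η s0 t).re = (s0.re + (η - 1 / 2)) / 2 := by
  simp [lowerParam]

lemma shiftParam_re (t : ℝ) :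
    (shiftParam η s0 s t).re = (η - 1 / 2 - s0.re) / 2 + 1 / 2 - s.re := by
  simp [shiftParam]

lemma shiftParam_im (t : ℝ) : (shiftParam η s0 s t).im = (t - s0.im) / 2 - s.im := by
  simp [shiftParam]

lemma barnesParams (hη : 40 < η) (hre : ∀ i, (α i).re = 0) (hsum : α 0 + α 1 + α 2 = 0)
    (h₁ : 1/100 < s0.re) (h₂ : s.re < 4) (h₃ : 0 < 2 * s.re - s0.re - 1/100)
    (hodd : ∀ k : ℤ, 2 * s.re + s0.re - η + 1/2 ≠ 2 * k + 1) (t : ℝ) :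
    BarnesParams (upperParams α s0 s) (lowerParam η s0 t) (shiftParam η s0 s t) (1 / 200) where
  pos := by norm_num
  lt_re i := by
    fin_cases i <;> simp [upperParams, hre] <;> linarith
  re_c_pos := by rw [shiftParam_re]; linarith
  re_c_ne k hk := by
    rw [shiftParam_re] at hk
    refine hodd (-k) ?_
    push_cast
    linarith
  re_lt := by
    rw [lowerParam_re]
    simp [upperParams, hre]
    linarith
  balance := by
    simp [upperParams, lowerParam, shiftParam]
    linear_combination -hsum / 2

lemma growthBound_outerFactor (hη : 40 < η) (hre : ∀ i, (α i).re = 0) :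
    GrowthBound (fun _ t => outerFactor η α H s0 s t) 0 0 (-(Real.pi / 2) + 2 / 100) := by
  have hM : GrowthBound (fun _ t => mellinT (Hflat H) (s - outerPoint η t - 1/2)) 0 0 0 := by
    refine GrowthBound.of_bound (C := ∫ y in Ioi (0 : ℝ), ‖Hflat H y‖ * y ^ (s.re - η - 1)) fun t => ?_
    rw [zero_mul, Real.exp_zero, mul_one]
    exact norm_mellinT_le _ (by simp; ring)
  have hP : GrowthBound (fun _ t => (Real.pi : ℂ) ^ (-outerPoint η t)) 0 0 0 := by
    refine GrowthBound.of_bound (C := Real.pi ^ (-(η - 1 / 2))) fun t => ?_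
    rw [norm_cpow_eq_rpow_re_of_pos Real.pi_pos]
    simp
  have hG := fun i => growthBound_Gamma_decay (fun t => (outerPoint η t - α i) / 2)
    (σ := (η - 1 / 2) / 2) (l := 1 / 2) (m := |(α i).im| / 2) (ε := 1 / 100) (by linarith)
    (by norm_num) (by linarith [Real.pi_gt_three]) (fun t => by simp [hre]) (fun t => by
      have := abs_sub_abs_le_abs_sub t (α i).im
      simp only [div_ofNat_im, sub_im, outerPoint_im, abs_div, Nat.abs_ofNat]
      linarith)
  have hI := (growthBound_inv_Gamma (fun t => (1 + outerPoint η t) / 2 - s0)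
    (σ := (1 + (η - 1 / 2)) / 2 - s0.re) (l := 1 / 2) (m := |s0.im|) (ε := 1 / 100)
    (by norm_num) (by norm_num) (fun t => by simp) (fun t => by
      have := abs_sub (t / 2) s0.im
      rw [abs_div, Nat.abs_ofNat] at this
      simp
      linarith)).at_zero
  refine ((hM.mul ((((hG 0).mul (hG 1)).mul (hG 2)).mul hI)).mul hP).congr (fun N t => ?_)
    (by norm_num) (by norm_num) (by linarith)
  simp [outerFactor, Fin.prod_univ_three, div_eq_mul_inv]

@[fun_prop]
lemma measurable_outerPoint : Measurable (outerPoint η) := continuous_outerPoint.measurable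

@[fun_prop]
lemma measurable_lowerParam : Measurable (lowerParam η s0) := by unfold lowerParam; fun_prop

@[fun_prop]
lemma measurable_shiftParam : Measurable (shiftParam η s0 s) := by unfold shiftParam; fun_prop

lemma measurable_outerFactor : Measurable (outerFactor η α H s0 s) := by
  have hM : Measurable fun t => mellinT (Hflat H) (s - outerPoint η t - 1/2) :=
    (continuous_mellinT_of_re_eq (σ := s.re - (η - 1 / 2) - 1 / 2) _
      (by have := continuous_outerPoint (η := η); fun_prop) (fun t => by simp)).measurable
  unfold outerFactor
  fun_prop

variable (a : Fin 4 → ℂ)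

lemma measurable_hypTerm {b c w : ℝ → ℂ} (hb : Measurable b) (hc : Measurable c)
    (hw : Measurable w) : Measurable fun t => hypTerm a (b t) (c t) (w t) := by
  unfold hypTerm
  fun_prop

lemma integrable_outerFactor_mul_tsum (hη : 40 < η) (hre : ∀ i, (α i).re = 0)
    (hc : ∀ k : ℤ, (η - 1 / 2 - s0.re) / 2 + 1 / 2 - s.re ≠ k) {b c w : ℝ → ℂ}
    (hb : Measurable b) (hc' : Measurable c) (hw : Measurable w) {κ : ℝ}
    (hκ : κ < Real.pi - 2 / 100)
    (hQ : GrowthBound (fun N t => hypTerm a (b t) (c t) (w t + N)) 0 (-2) κ) :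
    Integrable fun t => outerFactor η α H s0 s t * (sin (Real.pi * shiftParam η s0 s t))⁻¹ *
      ∑' n : ℕ, hypTerm a (b t) (c t) (w t + n) := by
  have hS := growthBound_inv_sin (shiftParam η s0 s) (l := 1 / 2) (m := |s0.im| / 2 + |s.im|) hc
    shiftParam_re (fun t => by
      rw [shiftParam_im]
      have h1 := abs_sub_abs_le_abs_sub (t / 2) (s0.im / 2 + s.im)
      have h2 := abs_add_le (s0.im / 2) s.im
      rw [abs_div, Nat.abs_ofNat] at h1 h2
      rw [show (t - s0.im) / 2 - s.im = t / 2 - (s0.im / 2 + s.im) by ring]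
      linarith)
  obtain ⟨C, hC, hT⟩ := hQ.exists_norm_tsum_le
  have hB := (((growthBound_outerFactor (s0 := s0) (s := s) H hη hre).mul hS).mul
    (GrowthBound.of_bound hT))
  refine integrable_of_growthBound ?_ (hB.congr (fun _ _ => rfl) (by norm_num) (by norm_num) le_rfl)
    (by linarith)
  have hT' : Measurable fun t => ∑' n : ℕ, hypTerm a (b t) (c t) (w t + n) :=
    measurable_tsum_of_summable (fun n => measurable_hypTerm a hb hc' (by fun_prop)) hQ.summable
  have := measurable_outerFactor (η := η) (α := α) H (s0 := s0) (s := s)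
  fun_prop

end Transform

end Lemmas

/-- Hypergeometric expression for the archimedean transform (Proposition 9.4 of the
paper). -/
theorem hypergeometric_expression (η : ℝ) (hη : 40 < η)
    (H : ℂ → ℂ) (hH : MemCeta η H)
    (α : Fin 3 → ℂ) (hre : ∀ i, (α i).re = 0) (hsum : α 0 + α 1 + α 2 = 0)
    (s0 s : ℂ)
    (h₁ : 1/100 < s0.re) (h₂ : s.re < 4) (h₃ : 0 < 2 * s.re - s0.re - 1/100)
    (hodd : ∀ k : ℤ, 2 * s.re + s0.re - η + 1/2 ≠ 2 * k + 1) :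
    FtransMain η α H s0 s =
      2 * (Real.pi : ℂ) ^ ((3 : ℂ) / 2) *
        (((1 / (2 * (Real.pi : ℂ))) * ∫ t1 : ℝ,
            let s1 : ℂ := ((η : ℝ) - 1/2 : ℝ) + t1 * Complex.I
            mellinT (Hflat H) (s - s1 - 1/2) *
              ((∏ i, Complex.Gamma ((s1 - α i) / 2)) /
                Complex.Gamma ((1 + s1) / 2 - s0)) *
              (Real.pi : ℂ) ^ (-s1) *
              (1 / Complex.cos ((Real.pi : ℂ) * (2 * s + s0 - s1) / 2)) *
              hyp4F3hat (s - s0 / 2) ((s0 + α 0) / 2) ((s0 + α 1) / 2) ((s0 + α 2) / 2)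
                (1/2) ((s0 + s1) / 2) (s + 1/2 + (s0 - s1) / 2)) -
          ((1 / (2 * (Real.pi : ℂ))) * ∫ t1 : ℝ,
            let s1 : ℂ := ((η : ℝ) - 1/2 : ℝ) + t1 * Complex.I
            mellinT (Hflat H) (s - s1 - 1/2) *
              ((∏ i, Complex.Gamma ((s1 - α i) / 2)) /
                Complex.Gamma ((1 + s1) / 2 - s0)) *
              (Real.pi : ℂ) ^ (-s1) *
              (1 / Complex.cos ((Real.pi : ℂ) * (2 * s + s0 - s1) / 2)) *
              hyp4F3hat (1/2 - s0 + s1 / 2) (1/2 - s + (s1 + α 0) / 2)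
                (1/2 - s + (s1 + α 1) / 2) (1/2 - s + (s1 + α 2) / 2)
                (1/2 - s + s1) (1 - s - (s0 - s1) / 2) (3/2 - s - (s0 - s1) / 2))) := by
  have hP := barnesParams hη hre hsum h₁ h₂ h₃ hodd
  have hc : ∀ k : ℤ, (η - 1 / 2 - s0.re) / 2 + 1 / 2 - s.re ≠ k := fun k hk =>
    (hP 0).re_c_ne k (by rw [shiftParam_re, hk])
  have hc0 : 0 < (η - 1 / 2 - s0.re) / 2 + 1 / 2 - s.re := by
    rw [← shiftParam_re 0]; exact (hP 0).re_c_pos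
  have hβ : (upperParams α s0 s 0).re < (s0.re + (η - 1 / 2)) / 2 := by
    rw [← lowerParam_re (η := η) 0]; exact (hP 0).re_lt
  have hbal := (hP 0).re_balance
  rw [lowerParam_re, shiftParam_re] at hbal
  have him₁ : ∀ t, |(lowerParam η s0 t - upperParams α s0 s 0).im| ≤ 1 / 2 * |t| + |(α 0).im| / 2 := by
    intro t
    have := abs_sub t (α 0).im
    rw [show (lowerParam η s0 t - upperParams α s0 s 0).im = (t - (α 0).im) / 2 by
      simp [lowerParam, upperParams]; ring, abs_div, Nat.abs_ofNat]
    linarith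
  have himc : ∀ t, |(shiftParam η s0 s t).im| ≤ 1 / 2 * |t| + (|s0.im| / 2 + |s.im|) := by
    intro t
    have h1 := abs_sub (t / 2) (s0.im / 2 + s.im)
    have h2 := abs_add_le (s0.im / 2) s.im
    rw [abs_div, Nat.abs_ofNat] at h1 h2
    rw [shiftParam_im, show (t - s0.im) / 2 - s.im = t / 2 - (s0.im / 2 + s.im) by ring]
    linarith
  have hQ₁ := growthBound_hypTerm (upperParams α s0 s) (lowerParam η s0) (shiftParam η s0 s)
    (fun _ => 0) (ε := 1 / 100) (σ := 0) (l₂ := 0) (m₂ := 0) (l₃ := 1 / 2) (by norm_num) (by norm_num) le_rfl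
    (by norm_num) lowerParam_re shiftParam_re (fun _ => rfl)
    (fun i => by simpa using (hP 0).re_pos i) hβ hbal him₁ (fun t => by simp)
    (fun t => by simpa only [zero_sub, neg_im, abs_neg] using himc t)
  have hQ₂ := growthBound_hypTerm (upperParams α s0 s) (lowerParam η s0) (shiftParam η s0 s)
    (shiftParam η s0 s) (ε := 1 / 100) (l₃ := 0) (m₃ := 0) (by norm_num) (by norm_num)
    (by norm_num) le_rfl lowerParam_re shiftParam_re shiftParam_re
    (fun i => add_pos ((hP 0).re_pos i) hc0) hβ hbal him₁ himc (fun t => by simp)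
  have hI₁ := integrable_outerFactor_mul_tsum H (upperParams α s0 s) hη hre hc (by fun_prop)
    (by fun_prop) (by fun_prop) (by linarith [Real.pi_gt_three]) hQ₁
  have hI₂ := integrable_outerFactor_mul_tsum H (upperParams α s0 s) hη hre hc (by fun_prop)
    (by fun_prop) (by fun_prop) (by linarith [Real.pi_gt_three]) hQ₂
  simp only [zero_add] at hI₁
  have hpt : ∀ t : ℝ, ((η - 1 / 2 : ℝ) : ℂ) + t * I = outerPoint η t := fun _ => rfl
  have hpi : (Real.pi : ℂ) ≠ 0 := ofReal_ne_zero.2 Real.pi_ne_zero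
  have hinner : ∀ t : ℝ, ∫ v : ℝ, outerFactor η α H s0 s t * barnesIntegrand (upperParams α s0 s)
      (lowerParam η s0 t) (shiftParam η s0 s t) ((1 / 200 : ℝ) + (v / 2 : ℝ) * I) =
      4 * Real.pi ^ 2 * (outerFactor η α H s0 s t * (sin (Real.pi * shiftParam η s0 s t))⁻¹ *
        ∑' n : ℕ, hypTerm (upperParams α s0 s) (lowerParam η s0 t) (shiftParam η s0 s t) n -
        outerFactor η α H s0 s t * (sin (Real.pi * shiftParam η s0 s t))⁻¹ *
        ∑' n : ℕ, hypTerm (upperParams α s0 s) (lowerParam η s0 t) (shiftParam η s0 s t)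
          (shiftParam η s0 s t + n)) := by
    intro t
    rw [integral_const_mul, Measure.integral_comp_div (fun y : ℝ => barnesIntegrand
      (upperParams α s0 s) (lowerParam η s0 t) (shiftParam η s0 s t) ((1 / 200 : ℝ) + y * I)),
      (hP t).integral_eq, Nat.abs_ofNat, real_smul]
    push_cast
    ring
  have hcos : ∀ t : ℝ, cos ((Real.pi : ℂ) * (2 * s + s0 - outerPoint η t) / 2) =
      sin (Real.pi * shiftParam η s0 s t) := by
    intro t
    rw [← cos_neg, ← sin_add_pi_div_two, shiftParam]
    congr 1
    ring
  have hseries₁ : ∀ t : ℝ, hyp4F3hat (s - s0 / 2) ((s0 + α 0) / 2) ((s0 + α 1) / 2)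
      ((s0 + α 2) / 2) (1/2) ((s0 + outerPoint η t) / 2) (s + 1/2 + (s0 - outerPoint η t) / 2) =
      ∑' n : ℕ, hypTerm (upperParams α s0 s) (lowerParam η s0 t) (shiftParam η s0 s t) n := by
    intro t
    rw [← hyp4F3hat_eq_tsum_hypTerm]
    congr 1
    rw [shiftParam]
    ring
  have hseries₂ : ∀ t : ℝ, hyp4F3hat (1/2 - s0 + outerPoint η t / 2)
      (1/2 - s + (outerPoint η t + α 0) / 2) (1/2 - s + (outerPoint η t + α 1) / 2)
      (1/2 - s + (outerPoint η t + α 2) / 2) (1/2 - s + outerPoint η t)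
      (1 - s - (s0 - outerPoint η t) / 2) (3/2 - s - (s0 - outerPoint η t) / 2) =
      ∑' n : ℕ, hypTerm (upperParams α s0 s) (lowerParam η s0 t) (shiftParam η s0 s t)
        (shiftParam η s0 s t + n) := by
    intro t
    rw [← hyp4F3hat_eq_tsum_hypTerm_add]
    congr 1 <;> simp [upperParams, shiftParam, lowerParam] <;> ring
  have hconst : (Real.pi : ℂ) ^ ((3 : ℂ) / 2) = Real.pi * Real.sqrt Real.pi := by
    rw [show (3 : ℂ) / 2 = 1 + ((1 / 2 : ℝ) : ℂ) by push_cast; norm_num, cpow_add _ _ hpi, cpow_one,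
      ← ofReal_cpow Real.pi_pos.le, Real.sqrt_eq_rpow]
  have hF : FtransMain η α H s0 s = (Real.sqrt Real.pi : ℂ) * (1 / (2 * (Real.pi : ℂ))) ^ 2 *
      ∫ t : ℝ, ∫ v : ℝ, outerFactor η α H s0 s t * barnesIntegrand (upperParams α s0 s)
        (lowerParam η s0 t) (shiftParam η s0 s t) ((1 / 200 : ℝ) + (v / 2 : ℝ) * I) := by
    rw [FtransMain]
    congr 2 with t
    congr 1 with v
    simp only [hpt, outerFactor, barnesIntegrand, barnesRegular, Fin.prod_univ_three]
    have hu : ((1 / 200 : ℝ) + (v / 2 : ℝ) * I : ℂ) = (1 / 100 + v * I) / 2 := by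
      push_cast; ring
    rw [hu]
    set u : ℂ := 1 / 100 + v * I
    have e₁ : shiftParam η s0 s t + u / 2 = (outerPoint η t - s0 + u) / 2 + 1 / 2 - s := by
      rw [shiftParam]; ring
    have e₂ : ∀ z : ℂ, (s0 + z) / 2 - u / 2 = (s0 - u + z) / 2 := fun z => by ring
    have e₃ : (1 / 2 : ℂ) - u / 2 = (1 - u) / 2 := by ring
    have e₄ : s - s0 / 2 - u / 2 = s - (s0 + u) / 2 := by ring
    rw [e₁]
    simp only [upperParams, lowerParam, Matrix.cons_val, e₂, e₃, e₄]
    simp only [div_eq_mul_inv, mul_inv]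
    ring
  rw [hF]
  simp only [hpt, hcos, hseries₁, hseries₂, hinner]
  rw [integral_const_mul, integral_sub hI₁ hI₂, hconst]
  simp only [outerFactor, one_div]
  field_simp
  norm_num
end

section
/- Key Iwasawa matrix identity: Let a₀ ∈ ℝ and y₀, y₁ > 0, and set r := 1 + (a₀ y₀)². Let L be the 3×3 lower unitriangular matrix with (3,2)-entry −a₀ (all other off-diagonal entries 0), let Y := diag(y₀y₁, y₀, 1), let N be the 3×3 upper unitriangular matrix with (1,2)- and (1,3)-entries 0 and (2,3)-entry −a₀y₀²/r, and let D := diag((y₀/r)·(y₁√r), y₀/r, 1). Then there exist an orthogonal matrix k ∈ O(3, ℝ) and a real number λ > 0 such that L·Y = λ·(N·D·k). -/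
open Matrix

/-- Key Iwasawa matrix identity (equation (6.4) of the paper): the lower-unitriangular
translate `L·Y` agrees with `N·D` up to a positive scalar and a right orthogonal
factor. -/
theorem iwasawa_matrix_identity (a₀ y₀ y₁ : ℝ) (hy₀ : 0 < y₀) (hy₁ : 0 < y₁) :
    ∃ (k : Matrix (Fin 3) (Fin 3) ℝ) (lam : ℝ),
      k * kᵀ = 1 ∧ 0 < lam ∧
      (!![1, 0, 0; 0, 1, 0; 0, -a₀, 1] : Matrix (Fin 3) (Fin 3) ℝ) *
          !![y₀ * y₁, 0, 0; 0, y₀, 0; 0, 0, 1] =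
        lam • ((!![1, 0, 0; 0, 1, -a₀ * y₀ ^ 2 / (1 + (a₀ * y₀) ^ 2); 0, 0, 1] :
            Matrix (Fin 3) (Fin 3) ℝ) *
          !![(y₀ / (1 + (a₀ * y₀) ^ 2)) * (y₁ * Real.sqrt (1 + (a₀ * y₀) ^ 2)), 0, 0;
             0, y₀ / (1 + (a₀ * y₀) ^ 2), 0; 0, 0, 1] * k) := by
  have hr : 0 < 1 + (a₀ * y₀) ^ 2 := by positivity
  have hs : 0 < Real.sqrt (1 + (a₀ * y₀) ^ 2) := Real.sqrt_pos.mpr hr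
  have hsq : Real.sqrt (1 + (a₀ * y₀) ^ 2) ^ 2 = 1 + (a₀ * y₀) ^ 2 := Real.sq_sqrt hr.le
  set s := Real.sqrt (1 + (a₀ * y₀) ^ 2)
  rw [← hsq]
  refine ⟨!![1, 0, 0; 0, 1 / s, a₀ * y₀ / s; 0, -(a₀ * y₀) / s, 1 / s], s, ?_, hs, ?_⟩
  · ext i j
    fin_cases i <;> fin_cases j <;>
      simp [Matrix.mul_apply, Fin.sum_univ_three] <;> field_simp <;> linarith
  · ext i j
    fin_cases i <;> fin_cases j <;>
      simp [Matrix.mul_apply, Fin.sum_univ_three, -zero_eq_mul] <;> field_simp <;> linarith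
end
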